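/- arXiv:2505.12156 — 2 statements merged into one kernel-verified Lean document; each statement's English description precedes it below -/
import Mathlib

section
/- Let Q be a finite quiver, v : Q₀ → ℕ a dimension vector, and I ⊆ Q₀ a subset. Then the fixed subalgebra of the GL(v|_I)-action on the polynomial ring R_{Q,v}, i.e. the set of all elements fixed by every group element, equals the ℂ-subalgebra of R_{Q,v} generated by: (1) the trace polynomials tr(X_{a_l}⋯X_{a_1}) over all cycles a_l,…,a_1 in Q (paths with source equal to target) all of whose arrows have both source and target in I; and (2) all matrix entries of the products X_{a_l}⋯X_{a_1} over all paths a_l,…,a_1 of length ≥ 1 in Q whose source s(a_1) and target t(a_l) both lie in Q₀ ∖ I (with no condition on intermediate vertices). (Le Bruyn–Procesi theorem with frozen vertices.) -/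
noncomputable section

open scoped BigOperators MatrixGroups

namespace Stmt4

variable {Q₀ Q₁ : Type} [Fintype Q₀] [DecidableEq Q₀] [Fintype Q₁]

/-- Index type of the variables `x^a_{p,q}` of `R_{Q,v}`. -/
def Var (s t : Q₁ → Q₀) (v : Q₀ → ℕ) : Type :=
  Σ a : Q₁, Fin (v (t a)) × Fin (v (s a))

/-- The polynomial ring `R_{Q,v}`. -/
abbrev R (s t : Q₁ → Q₀) (v : Q₀ → ℕ) : Type := MvPolynomial (Var s t v) ℂ

/-- The action of `g` on `R_{Q,v}` by `ℂ`-algebra automorphisms: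
`x^a_{p,q} ↦ (g_{t a} · X_a · g_{s a}⁻¹)_{p,q}`. -/
def act (s t : Q₁ → Q₀) (v : Q₀ → ℕ) (g : ∀ i : Q₀, GL (Fin (v i)) ℂ) :
    R s t v →ₐ[ℂ] R s t v :=
  MvPolynomial.aeval fun x : Var s t v =>
    ∑ p' : Fin (v (t x.1)), ∑ q' : Fin (v (s x.1)),
      MvPolynomial.C ((g (t x.1)).val x.2.1 p') *
        MvPolynomial.X (⟨x.1, (p', q')⟩ : Var s t v) *
        MvPolynomial.C (((g (s x.1))⁻¹).val q' x.2.2)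

/-- The total index space `⨆_i Fin (v i)`. -/
abbrev V (v : Q₀ → ℕ) : Type := Σ i : Q₀, Fin (v i)

/-- The generic matrix of an arrow `a`, placed as the block `(t a, s a)` of a big
square matrix indexed by `V v` (all other entries being `0`). -/
def B (s t : Q₁ → Q₀) (v : Q₀ → ℕ) (a : Q₁) : Matrix (V v) (V v) (R s t v) :=
  fun pp qq =>
    if h : pp.1 = t a ∧ qq.1 = s a then
      MvPolynomial.X (⟨a, (Fin.cast (congrArg v h.1) pp.2,
        Fin.cast (congrArg v h.2) qq.2)⟩ : Var s t v)
    else 0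

/-- The product `X_{a_l} ⋯ X_{a_1}` along a list of arrows `[a_l, …, a_1]`,
as a big square matrix. -/
def prodAlong (s t : Q₁ → Q₀) (v : Q₀ → ℕ) (L : List Q₁) : Matrix (V v) (V v) (R s t v) :=
  (L.map (B s t v)).prod

/-- Trace generators: traces along cycles all of whose arrows have source and target in `I`. -/
def traceGens (s t : Q₁ → Q₀) (v : Q₀ → ℕ) (I : Set Q₀) : Set (R s t v) :=
  {f | ∃ (L : List Q₁) (h : L ≠ []),
      L.Chain' (fun x y => s x = t y) ∧
      s (L.getLast h) = t (L.head h) ∧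
      (∀ a ∈ L, s a ∈ I ∧ t a ∈ I) ∧
      f = Matrix.trace (prodAlong s t v L)}

/-- Entry generators: entries of products along paths starting and ending outside `I`. -/
def entryGens (s t : Q₁ → Q₀) (v : Q₀ → ℕ) (I : Set Q₀) : Set (R s t v) :=
  {f | ∃ (L : List Q₁) (h : L ≠ []) (p q : V v),
      L.Chain' (fun x y => s x = t y) ∧
      s (L.getLast h) ∉ I ∧ t (L.head h) ∉ I ∧
      f = prodAlong s t v L p q}

section Helpers

set_option linter.unusedSectionVars false

open scoped Matrix

theorem bicomm {m : Type*} [Fintype m] [DecidableEq m] (D : Submodule ℂ (Matrix m m ℂ))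
    (h1 : (1 : Matrix m m ℂ) ∈ D) (hmul : ∀ a ∈ D, ∀ b ∈ D, a * b ∈ D)
    (hstar : ∀ a ∈ D, aᴴ ∈ D) (F : Matrix m m ℂ)
    (hF : ∀ T : Matrix m m ℂ, (∀ d ∈ D, T * d = d * T) → F * T = T * F) : F ∈ D := by
  classical
  let e : Matrix m m ℂ ≃ₗ[ℂ] EuclideanSpace ℂ (m × m) :=
    { toFun := fun A => WithLp.toLp 2 fun ij => A ij.1 ij.2
      invFun := fun x => Matrix.of fun i j => x (i, j)
      map_add' := fun _ _ => rfl
      map_smul' := fun _ _ => rfl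
      left_inv := fun _ => rfl
      right_inv := fun _ => rfl }
  have he : ∀ (A : Matrix m m ℂ) ij, (e A) ij = A ij.1 ij.2 := fun _ _ => rfl
  have hinner : ∀ A B : Matrix m m ℂ, inner ℂ (e A) (e B) = (Aᴴ * B).trace := by
    intro A B
    simp only [PiLp.inner_apply, Matrix.trace, Matrix.diag, Matrix.mul_apply, he,
      Fintype.sum_prod_type, Matrix.conjTranspose_apply]
    rw [Finset.sum_comm]
    simp [mul_comm]
  let K : Submodule ℂ (EuclideanSpace ℂ (m × m)) := D.map e.toLinearMap
  let P : Matrix m m ℂ →ₗ[ℂ] Matrix m m ℂ :=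
    e.symm.toLinearMap ∘ₗ (K.starProjection : _ →ₗ[ℂ] _) ∘ₗ e.toLinearMap
  have hPe : ∀ A, e (P A) = K.starProjection (e A) := fun A => by simp [P]
  have hK : ∀ A, e A ∈ K ↔ A ∈ D := fun A => by simp [K]
  have hPD : ∀ A, P A ∈ D := fun A => by
    rw [← hK, hPe]; exact Submodule.starProjection_apply_mem _ _
  have hPd : ∀ d ∈ D, ∀ A, P (d * A) = d * P A := by
    intro d hd A
    apply e.injective
    rw [hPe]
    apply Submodule.eq_starProjection_of_mem_orthogonal
    · rw [hK]; exact hmul _ hd _ (hPD A)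
    · rw [Submodule.mem_orthogonal]
      intro u hu
      obtain ⟨b, hb, rfl⟩ := hu
      have h2 : e A - e (P A) ∈ Kᗮ := by rw [hPe]; exact K.sub_starProjection_mem_orthogonal _
      have h3 := (Submodule.mem_orthogonal _ _).1 h2 (e (dᴴ * b)) ((hK _).2 (hmul _ (hstar _ hd) _ hb))
      rw [← map_sub, hinner] at h3
      change inner ℂ (e b) (e (d * A) - e (d * P A)) = 0
      rw [← map_sub, hinner, ← mul_sub, ← mul_assoc]
      simpa using h3
  let Q : m → m → Matrix m m ℂ := fun u w => Matrix.of fun r s => P (Matrix.single s u 1) r w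
  have hsing : ∀ (A : Matrix m m ℂ) (s u : m), A * Matrix.single s u (1:ℂ) = ∑ s', A s' s • Matrix.single s' u (1:ℂ) := by
    intro A s u
    ext i j
    simp [Matrix.sum_apply, Matrix.mul_apply, Matrix.single_apply, ite_and]
  have hcomm : ∀ A : Matrix m m ℂ, (∀ u w, A * Q u w = Q u w * A) ↔ ∀ s u, P (A * Matrix.single s u 1) = A * P (Matrix.single s u 1) := by
    intro A
    have key : ∀ u w r s, (Q u w * A) r s = P (A * Matrix.single s u 1) r w := by
      intro u w r s
      rw [hsing, map_sum]
      simp only [map_smul, Matrix.sum_apply, Matrix.mul_apply, Q, Matrix.of_apply,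
        Matrix.smul_apply, smul_eq_mul, mul_comm]
    have key2 : ∀ u w r s, (A * Q u w) r s = (A * P (Matrix.single s u 1)) r w := by
      intro u w r s
      simp [Matrix.mul_apply, Q]
    constructor
    · intro h s u
      ext r w
      rw [← key, ← key2, h]
    · intro h u w
      ext r s
      rw [key, key2, h]
  have hFP : ∀ s u, P (F * Matrix.single s u 1) = F * P (Matrix.single s u 1) := by
    rw [← hcomm]
    intro u w
    apply hF
    intro d hd
    exact ((hcomm d).2 (fun s u => hPd d hd _) u w).symm
  have hP1 : P 1 = 1 := by
    apply e.injective
    rw [hPe]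
    exact Submodule.starProjection_eq_self_iff.2 ((hK _).2 h1)
  have h1s : (1 : Matrix m m ℂ) = ∑ i, Matrix.single i i 1 := by
    ext i j
    simp [Matrix.sum_apply, Matrix.single_apply, Matrix.one_apply, ite_and]
  have : P F = F := by
    calc P F = P (F * 1) := by rw [mul_one]
      _ = F * P 1 := by
        rw [h1s, Finset.mul_sum, map_sum, map_sum, Finset.mul_sum]
        exact Finset.sum_congr rfl fun i _ => hFP i i
      _ = F := by rw [hP1, mul_one]
  rw [← this]; exact hPD F

/-- Kronecker product of a tuple of matrices. -/
def kron {n : ℕ} {ι K : Type*} [CommSemiring K] (A : Fin n → Matrix ι ι K) :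
    Matrix (Fin n → ι) (Fin n → ι) K :=
  Matrix.of fun y x => ∏ k, A k (y k) (x k)

theorem kron_apply {n : ℕ} {ι K : Type*} [CommSemiring K] (A : Fin n → Matrix ι ι K) (y x) :
    kron A y x = ∏ k, A k (y k) (x k) := rfl

theorem kron_mul {n : ℕ} {ι K : Type*} [CommSemiring K] [Fintype ι]
    (A A' : Fin n → Matrix ι ι K) : kron A * kron A' = kron (fun k => A k * A' k) := by
  ext y x
  simp only [Matrix.mul_apply, kron_apply, Finset.prod_univ_sum, Fintype.piFinset_univ,
    Finset.prod_mul_distrib]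

theorem kron_comp {n : ℕ} {ι K : Type*} [CommSemiring K]
    (A : Fin n → Matrix ι ι K) (σ : Equiv.Perm (Fin n)) (y x) :
    kron (fun k => A (σ k)) (fun k => y (σ k)) (fun k => x (σ k)) = kron A y x := by
  simp only [kron_apply]
  exact Equiv.prod_comp σ (fun k => A k (y k) (x k))

/-- Sums inside a Kronecker product. -/
theorem kron_sum {n : ℕ} {ι K J : Type*} [CommSemiring K] [Fintype J]
    (A : Fin n → J → Matrix ι ι K) :
    kron (fun k => ∑ j, A k j) = ∑ φ : Fin n → J, kron (fun k => A k (φ k)) := by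
  classical
  ext y x
  simp only [kron_apply, Matrix.sum_apply, Finset.prod_univ_sum, Fintype.piFinset_univ]

theorem kron_one {n : ℕ} {ι K : Type*} [CommSemiring K] [DecidableEq ι] :
    kron (fun _ : Fin n => (1 : Matrix ι ι K)) = 1 := by
  ext y x
  simp only [kron_apply, Matrix.one_apply, Finset.prod_ite_zero, funext_iff]
  simp

theorem kron_smul {n : ℕ} {ι K : Type*} [CommSemiring K] (z : Fin n → K)
    (A : Fin n → Matrix ι ι K) : kron (fun k => z k • A k) = (∏ k, z k) • kron A := by
  ext y x
  simp [kron_apply, Finset.prod_mul_distrib]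

/-- Permuted Kronecker products. -/
def dmat {n : ℕ} {ι K : Type*} [CommSemiring K] (σ : Equiv.Perm (Fin n))
    (A : Fin n → Matrix ι ι K) : Matrix (Fin n → ι) (Fin n → ι) K :=
  Matrix.of fun y x => ∏ k, A k (y k) (x (σ k))

theorem dmat_apply {n : ℕ} {ι K : Type*} [CommSemiring K] (σ : Equiv.Perm (Fin n))
    (A : Fin n → Matrix ι ι K) (y x) :
    dmat σ A y x = kron A y (fun k => x (σ k)) := rfl

theorem dmat_mul {n : ℕ} {ι K : Type*} [CommSemiring K] [Fintype ι]
    (σ τ : Equiv.Perm (Fin n)) (A A' : Fin n → Matrix ι ι K) :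
    dmat σ A * dmat τ A' = dmat (τ * σ) (fun k => A k * A' (σ k)) := by
  classical
  ext y x
  rw [dmat_apply, ← kron_mul, Matrix.mul_apply, Matrix.mul_apply]
  refine Fintype.sum_equiv (Equiv.arrowCongr σ.symm (Equiv.refl ι)) _ _ fun z => ?_
  rw [dmat_apply, dmat_apply, ← kron_comp A' σ]
  rfl

theorem dmat_star {n : ℕ} {ι : Type*} (σ : Equiv.Perm (Fin n)) (A : Fin n → Matrix ι ι ℂ) :
    (dmat σ A)ᴴ = dmat σ⁻¹ (fun k => (A (σ⁻¹ k))ᴴ) := by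
  ext y x
  simp only [dmat, Matrix.conjTranspose_apply, Matrix.of_apply, star_prod]
  refine Fintype.prod_equiv σ _ _ fun k => ?_
  simp

theorem dmat_one {n : ℕ} {ι K : Type*} [CommSemiring K] (A : Fin n → Matrix ι ι K) :
    dmat 1 A = kron A := rfl

/-- Polarization. -/
theorem polar {n : ℕ} (c : (Fin n → Fin n) → ℂ)
    (h : ∀ z : Fin n → ℂ, ∑ φ : Fin n → Fin n, (∏ k, z (φ k)) * c φ = 0) :
    ∑ σ : Equiv.Perm (Fin n), c σ = 0 := by
  classical
  let p : MvPolynomial (Fin n) ℂ := ∑ φ : Fin n → Fin n, MvPolynomial.monomial (∑ k, Finsupp.single (φ k) 1) (c φ)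
  have hp : p = 0 := by
    apply MvPolynomial.funext
    intro z
    rw [map_zero, ← h z, map_sum]
    refine Finset.sum_congr rfl fun φ _ => ?_
    rw [MvPolynomial.monomial_sum_index, map_mul, MvPolynomial.eval_C, map_prod, mul_comm]
    simp [MvPolynomial.eval_monomial]
  have hc := congrArg (MvPolynomial.coeff (∑ k, Finsupp.single k 1)) hp
  rw [MvPolynomial.coeff_zero, MvPolynomial.coeff_sum] at hc
  rw [← hc]
  simp only [MvPolynomial.coeff_monomial]
  rw [← Finset.sum_filter]
  refine Finset.sum_bij (fun σ _ => ⇑σ) ?_ ?_ ?_ ?_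
  · intro σ _
    simp only [Finset.mem_filter, Finset.mem_univ, true_and]
    exact Equiv.sum_comp σ (fun k => Finsupp.single k 1)
  · intro a _ b _ hab
    exact DFunLike.coe_injective hab
  · intro φ hφ
    simp only [Finset.mem_filter, Finset.mem_univ, true_and] at hφ
    have hs : Function.Surjective φ := by
      intro j
      by_contra hj
      push Not at hj
      have := DFunLike.congr_fun hφ j
      simp [Finsupp.finsetSum_apply, Finsupp.single_apply, hj] at this
    exact ⟨Equiv.ofBijective φ (Finite.surjective_iff_bijective.1 hs), Finset.mem_univ _, rfl⟩
  · intro _ _; rfl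

theorem schurWeyl {n : ℕ} {ι J : Type*} [Fintype ι] [DecidableEq ι] [Fintype J]
    (C C' : Submodule ℂ (Matrix ι ι ℂ))
    (h1 : (1 : Matrix ι ι ℂ) ∈ C) (hmul : ∀ a ∈ C, ∀ b ∈ C, a * b ∈ C)
    (hstar : ∀ a ∈ C, aᴴ ∈ C) (u w : J → Matrix ι ι ℂ) (hu : ∀ j, u j ∈ C) (hw : ∀ j, w j ∈ C)
    (huw : ∑ j, u j * w j = 1) (hπ : ∀ A, ∑ j, u j * A * w j ∈ C')
    (F : Matrix (Fin n → ι) (Fin n → ι) ℂ)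
    (hF : ∀ A ∈ C', F * kron (fun _ => A) = kron (fun _ => A) * F) :
    F ∈ Submodule.span ℂ {d | ∃ (σ : Equiv.Perm (Fin n)) (c : Fin n → Matrix ι ι ℂ),
      (∀ k, c k ∈ C) ∧ d = dmat σ c} := by
  classical
  set X : Set (Matrix (Fin n → ι) (Fin n → ι) ℂ) :=
    {d | ∃ (σ : Equiv.Perm (Fin n)) (c : Fin n → Matrix ι ι ℂ), (∀ k, c k ∈ C) ∧ d = dmat σ c}
    with hX
  apply bicomm
  · apply Submodule.subset_span
    exact ⟨1, fun _ => 1, fun _ => h1, by rw [dmat_one, kron_one]⟩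
  · intro a ha b hb
    induction ha, hb using Submodule.span_induction₂ with
    | mem_mem x y hx hy =>
      obtain ⟨σ, c, hc, rfl⟩ := hx
      obtain ⟨τ, c', hc', rfl⟩ := hy
      apply Submodule.subset_span
      exact ⟨_, _, fun k => hmul _ (hc k) _ (hc' (σ k)), dmat_mul _ _ _ _⟩
    | zero_left => simp
    | zero_right => simp
    | add_left x y z _ _ _ h h' => rw [add_mul]; exact add_mem h h'
    | add_right x y z _ _ _ h h' => rw [mul_add]; exact add_mem h h'
    | smul_left r x y _ _ h => rw [smul_mul_assoc]; exact Submodule.smul_mem _ _ h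
    | smul_right r x y _ _ h => rw [mul_smul_comm]; exact Submodule.smul_mem _ _ h
  · intro a ha
    induction ha using Submodule.span_induction with
    | mem x hx =>
      obtain ⟨σ, c, hc, rfl⟩ := hx
      apply Submodule.subset_span
      exact ⟨_, _, fun k => hstar _ (hc _), dmat_star _ _⟩
    | zero => simp
    | add x y _ _ h h' => rw [Matrix.conjTranspose_add]; exact add_mem h h'
    | smul r x _ h => rw [Matrix.conjTranspose_smul]; exact Submodule.smul_mem _ _ h
  intro T hT
  have hTk : ∀ c : Fin n → Matrix ι ι ℂ, (∀ k, c k ∈ C) → T * kron c = kron c * T := by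
    intro c hc
    exact hT _ (Submodule.subset_span ⟨1, c, hc, rfl⟩)
  have hsym : ∀ (σ : Equiv.Perm (Fin n)) (y x : Fin n → ι),
      T (fun k => y (σ k)) (fun k => x (σ k)) = T y x := by
    intro σ y x
    have h := hT _ (Submodule.subset_span ⟨σ, fun _ => 1, fun _ => h1, rfl⟩)
    have h2 := congrFun (congrFun h (fun k => y (σ k))) x
    simp only [Matrix.mul_apply, dmat_apply, kron_one, Matrix.one_apply] at h2
    have h3 : ∀ z : Fin n → ι, ((fun k => y (σ k)) = fun k => z (σ k)) ↔ y = z := by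
      intro z
      constructor
      · intro h
        funext k
        simpa using congrFun h (σ.symm k)
      · rintro rfl; rfl
    simpa [h3] using h2
  let π : Matrix ι ι ℂ → Matrix ι ι ℂ := fun A => ∑ j, u j * A * w j
  have hsingle : ∀ p q : Fin n → ι,
      Matrix.single p q (1 : ℂ) = kron (fun k => Matrix.single (p k) (q k) (1 : ℂ)) := by
    intro p q
    ext y x
    simp only [kron_apply, Matrix.single_apply, Finset.prod_ite_zero, funext_iff]
    simp [forall_and]
  have hTsum : T = ∑ p, ∑ q, T p q • Matrix.single p q (1 : ℂ) := by
    conv_lhs => rw [Matrix.matrix_eq_sum_single T]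
    simp
  have hTπ : T = ∑ p, ∑ q, T p q • kron (fun k => π (Matrix.single (p k) (q k) (1 : ℂ))) := by
    have e1 : T = ∑ φ : Fin n → J, kron (fun k => u (φ k)) * T * kron (fun k => w (φ k)) := by
      have : (kron (fun _ : Fin n => ∑ j, u j * w j)) * T = T := by
        rw [huw, kron_one, one_mul]
      conv_lhs => rw [← this, kron_sum, Finset.sum_mul]
      refine Finset.sum_congr rfl fun φ _ => ?_
      rw [← kron_mul, mul_assoc, mul_assoc, hTk _ fun k => hw _]
    have e2 : ∀ p q, ∑ φ : Fin n → J, kron (fun k => u (φ k)) * Matrix.single p q (1 : ℂ) *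
        kron (fun k => w (φ k)) = kron (fun k => π (Matrix.single (p k) (q k) (1 : ℂ))) := by
      intro p q
      rw [kron_sum]
      refine Finset.sum_congr rfl fun φ _ => ?_
      rw [hsingle, kron_mul, kron_mul]
    conv_lhs => rw [e1]
    simp_rw [← e2]
    conv_lhs => enter [2, φ]; rw [hTsum]
    simp_rw [Finset.mul_sum, Finset.sum_mul, Finset.smul_sum]
    rw [Finset.sum_comm]
    refine Finset.sum_congr rfl fun p _ => ?_
    rw [Finset.sum_comm]
    refine Finset.sum_congr rfl fun q _ => Finset.sum_congr rfl fun φ _ => ?_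
    rw [mul_smul_comm, smul_mul_assoc]
  let br : Matrix (Fin n → ι) (Fin n → ι) ℂ →ₗ[ℂ] Matrix (Fin n → ι) (Fin n → ι) ℂ :=
    LinearMap.mulLeft ℂ F - LinearMap.mulRight ℂ F
  have hbr : ∀ A, br A = F * A - A * F := fun A => rfl
  have hpol : ∀ A : Fin n → Matrix ι ι ℂ, (∀ k, A k ∈ C') →
      ∑ σ : Equiv.Perm (Fin n), br (kron fun k => A (σ k)) = 0 := by
    intro A hA
    ext y x
    rw [Matrix.sum_apply]
    apply polar (fun φ => br (kron fun k => A (φ k)) y x)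
    intro z
    have h := hF (∑ j, z j • A j) (Submodule.sum_mem _ fun j _ => Submodule.smul_mem _ _ (hA j))
    rw [kron_sum, ← sub_eq_zero, ← hbr, map_sum] at h
    have h2 := congrFun (congrFun h y) x
    rw [Matrix.sum_apply] at h2
    rw [Matrix.zero_apply] at h2
    rw [← h2]
    refine Finset.sum_congr rfl fun φ _ => ?_
    rw [kron_smul, map_smul, Matrix.smul_apply, smul_eq_mul]
  have hfin : (Fintype.card (Equiv.Perm (Fin n)) : ℂ) • br T = 0 := by
    have e3 : ∀ σ : Equiv.Perm (Fin n), br T = ∑ p, ∑ q, T p q •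
        br (kron (fun k => π (Matrix.single (p (σ k)) (q (σ k)) (1 : ℂ)))) := by
      intro σ
      conv_lhs => rw [hTπ, map_sum]
      simp_rw [map_sum, map_smul]
      symm
      refine Fintype.sum_equiv (Equiv.arrowCongr σ.symm (Equiv.refl ι)) _ _ fun p => ?_
      refine Fintype.sum_equiv (Equiv.arrowCongr σ.symm (Equiv.refl ι)) _ _ fun q => ?_
      rw [← hsym σ p q]
      rfl
    have e4 : (Fintype.card (Equiv.Perm (Fin n)) : ℂ) • br T =
        ∑ σ : Equiv.Perm (Fin n), br T := by
      rw [Finset.sum_const, Finset.card_univ, Nat.cast_smul_eq_nsmul]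
    rw [e4, Finset.sum_congr rfl fun σ _ => e3 σ, Finset.sum_comm]
    refine Finset.sum_eq_zero fun p _ => ?_
    rw [Finset.sum_comm]
    refine Finset.sum_eq_zero fun q _ => ?_
    rw [← Finset.smul_sum,
      hpol (fun k => π (Matrix.single (p k) (q k) (1 : ℂ))) (fun k => hπ _), smul_zero]
  have : br T = 0 := (smul_eq_zero.1 hfin).resolve_left (by simp [Nat.factorial_ne_zero])
  rw [hbr, sub_eq_zero] at this
  exact this

theorem sum_fin_cons {n : ℕ} {β M : Type*} [Fintype β] [AddCommMonoid M]
    (h : (Fin (n + 1) → β) → M) : ∑ x, h x = ∑ b, ∑ x : Fin n → β, h (Fin.cons b x) := by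
  classical
  rw [← Fintype.sum_prod_type']
  exact (Fintype.sum_equiv (Fin.consEquiv fun _ => β) _ _ fun _ => rfl).symm

theorem perm_trace {ι K : Type*} [Fintype ι] [CommRing K] (S : Submonoid K)
    (Ys : Set (Matrix ι ι K)) (hmul : ∀ a ∈ Ys, ∀ b ∈ Ys, a * b ∈ Ys)
    (htr : ∀ a ∈ Ys, a.trace ∈ S) :
    ∀ (n : ℕ) (σ : Equiv.Perm (Fin n)) (Y : Fin n → Matrix ι ι K), (∀ k, Y k ∈ Ys) →
      ∑ x : Fin n → ι, ∏ k, Y k (x k) (x (σ k)) ∈ S := by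
  classical
  intro n
  induction n with
  | zero =>
    intro σ Y _
    simp
  | succ n ih =>
    intro σ Y hY
    obtain ⟨⟨o, e⟩, rfl⟩ := Equiv.Perm.decomposeFin.symm.surjective σ
    rw [sum_fin_cons]
    simp only [Fin.prod_univ_succ, Equiv.Perm.decomposeFin_symm_apply_zero,
      Equiv.Perm.decomposeFin_symm_apply_succ, Fin.cons_zero, Fin.cons_succ]
    induction o using Fin.cases with
    | zero =>
      simp only [Equiv.swap_self, Equiv.refl_apply, Fin.cons_zero, Fin.cons_succ]
      rw [← Finset.sum_mul_sum]
      exact mul_mem (htr _ (hY 0)) (ih e (fun k => Y k.succ) fun k => hY _)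
    | succ j =>
      let Y' : Fin n → Matrix ι ι K := fun k => if e k = j then Y k.succ * Y 0 else Y k.succ
      have hY' : ∀ k, Y' k ∈ Ys := by
        intro k
        simp only [Y']
        split_ifs
        · exact hmul _ (hY _) _ (hY _)
        · exact hY _
      convert ih e Y' hY' using 1
      rw [Finset.sum_comm]
      refine Finset.sum_congr rfl fun x _ => ?_
      have hk : ∀ k, k ≠ e.symm j → e k ≠ j := by
        intro k hk h
        exact hk (by rw [← h]; simp)
      rw [Finset.prod_eq_mul_prod_sdiff_singleton_of_mem (Finset.mem_univ (e.symm j))]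
      have : ∀ b : ι, ∏ k, Y k.succ (x k) ((Fin.cons b x : Fin (n + 1) → ι)
            (Equiv.swap 0 j.succ (e k).succ)) =
          Y (e.symm j).succ (x (e.symm j)) b *
            ∏ k ∈ Finset.univ \ {e.symm j}, Y' k (x k) (x (e k)) := by
        intro b
        rw [Finset.prod_eq_mul_prod_sdiff_singleton_of_mem (Finset.mem_univ (e.symm j))]
        congr 1
        · simp
        · refine Finset.prod_congr rfl fun k hk' => ?_
          have h1 : e k ≠ j := hk k (by simpa using hk')
          rw [Equiv.swap_apply_of_ne_of_ne (Fin.succ_ne_zero _) (fun h => h1 (Fin.succ_injective _ h))]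
          simp [Y', h1]
      simp_rw [this, ← mul_assoc]
      rw [← Finset.sum_mul]
      congr 1
      simp only [Y', Equiv.apply_symm_apply, if_true, Matrix.mul_apply, Fin.cons_succ]
      exact Finset.sum_congr rfl fun b _ => mul_comm _ _
section Inv

variable (s t : Q₁ → Q₀) (v : Q₀ → ℕ)

instance instFintypeVar : Fintype (Var s t v) :=
  inferInstanceAs (Fintype (Σ a : Q₁, Fin (v (t a)) × Fin (v (s a))))

/-- Block-diagonal matrix of a group element. -/
def gh (g : ∀ i : Q₀, GL (Fin (v i)) ℂ) : Matrix (V v) (V v) ℂ :=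
  Matrix.blockDiagonal' fun i => (g i).val

/-- Block-diagonal matrix of the inverse of a group element. -/
def ghi (g : ∀ i : Q₀, GL (Fin (v i)) ℂ) : Matrix (V v) (V v) ℂ :=
  Matrix.blockDiagonal' fun i => ((g i)⁻¹).val

theorem gh_mul_ghi (g : ∀ i : Q₀, GL (Fin (v i)) ℂ) : gh v g * ghi v g = 1 := by
  rw [gh, ghi, ← Matrix.blockDiagonal'_mul]
  simp [← Matrix.blockDiagonal'_one, Pi.one_def]

theorem ghi_mul_gh (g : ∀ i : Q₀, GL (Fin (v i)) ℂ) : ghi v g * gh v g = 1 := by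
  rw [gh, ghi, ← Matrix.blockDiagonal'_mul]
  simp [← Matrix.blockDiagonal'_one, Pi.one_def]

theorem gh_ne (g : ∀ i : Q₀, GL (Fin (v i)) ℂ) (x y : V v) (h : x.1 ≠ y.1) : gh v g x y = 0 :=
  Matrix.blockDiagonal'_apply_ne _ _ _ h

theorem ghi_ne (g : ∀ i : Q₀, GL (Fin (v i)) ℂ) (x y : V v) (h : x.1 ≠ y.1) : ghi v g x y = 0 :=
  Matrix.blockDiagonal'_apply_ne _ _ _ h

/-- Constructor of variables. -/
def mkVar (a : Q₁) (p : Fin (v (t a))) (q : Fin (v (s a))) : Var s t v := ⟨a, (p, q)⟩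

theorem B_ok (a : Q₁) (p : Fin (v (t a))) (q : Fin (v (s a))) :
    B s t v a ⟨t a, p⟩ ⟨s a, q⟩ = MvPolynomial.X (mkVar s t v a p q) :=
  dif_pos (show t a = t a ∧ s a = s a from ⟨rfl, rfl⟩)

theorem act_X (g : ∀ i : Q₀, GL (Fin (v i)) ℂ) (a : Q₁) (p : Fin (v (t a))) (q : Fin (v (s a))) :
    act s t v g (MvPolynomial.X (mkVar s t v a p q)) =
      ∑ p' : Fin (v (t a)), ∑ q' : Fin (v (s a)),
        MvPolynomial.C ((g (t a)).val p p') * MvPolynomial.X (mkVar s t v a p' q') *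
        MvPolynomial.C (((g (s a))⁻¹).val q' q) :=
  MvPolynomial.aeval_X _ _

theorem B_ne (a : Q₁) (x y : V v) (h : ¬ (x.1 = t a ∧ y.1 = s a)) : B s t v a x y = 0 := by
  simp only [B, dif_neg h]

theorem act_B (g : ∀ i : Q₀, GL (Fin (v i)) ℂ) (a : Q₁) :
    (B s t v a).map (act s t v g) =
      (gh v g).map MvPolynomial.C * B s t v a * (ghi v g).map MvPolynomial.C := by
  ext1 x y
  rw [Matrix.map_apply]
  simp only [Matrix.mul_apply, Matrix.map_apply, Finset.sum_mul]
  by_cases h : x.1 = t a ∧ y.1 = s a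
  · obtain ⟨i, p⟩ := x
    obtain ⟨j, q⟩ := y
    obtain ⟨rfl, rfl⟩ := h
    rw [B_ok, act_X]
    symm
    rw [Finset.sum_comm]
    rw [Fintype.sum_sigma, Finset.sum_eq_single (t a)]
    · refine Finset.sum_congr rfl fun p' _ => ?_
      rw [Fintype.sum_sigma, Finset.sum_eq_single (s a)]
      · refine Finset.sum_congr rfl fun q' _ => ?_
        rw [B_ok, gh, ghi, Matrix.blockDiagonal'_apply_eq, Matrix.blockDiagonal'_apply_eq]
      · intro j _ hj
        refine Finset.sum_eq_zero fun q' _ => ?_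
        rw [ghi_ne _ _ _ _ hj]; simp
      · simp
    · intro j _ hj
      refine Finset.sum_eq_zero fun q' _ => Finset.sum_eq_zero fun q' _ => ?_
      rw [gh_ne _ _ _ _ hj.symm]; simp
    · simp
  · rw [B_ne _ _ _ _ _ _ h, map_zero]
    symm
    refine Finset.sum_eq_zero fun y' _ => Finset.sum_eq_zero fun x' _ => ?_
    by_cases h1 : x.1 = x'.1
    · by_cases h2 : y'.1 = y.1
      · rw [B_ne _ _ _ _ x' y' (by rwa [← h1, h2])]; simp
      · rw [ghi_ne _ _ _ _ h2]; simp
    · rw [gh_ne _ _ _ _ h1]; simp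

theorem act_prodAlong (g : ∀ i : Q₀, GL (Fin (v i)) ℂ) (L : List Q₁) :
    (prodAlong s t v L).map (act s t v g) =
      (gh v g).map MvPolynomial.C * prodAlong s t v L * (ghi v g).map MvPolynomial.C := by
  have hi : (ghi v g).map (MvPolynomial.C (σ := Var s t v)) * (gh v g).map MvPolynomial.C = 1 := by
    rw [← Matrix.map_mul, ghi_mul_gh, Matrix.map_one _ (map_zero _) (map_one _)]
  have hi' : (gh v g).map (MvPolynomial.C (σ := Var s t v)) * (ghi v g).map MvPolynomial.C = 1 := by
    rw [← Matrix.map_mul, gh_mul_ghi, Matrix.map_one _ (map_zero _) (map_one _)]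
  induction L with
  | nil =>
    simp only [prodAlong, List.map_nil, List.prod_nil, mul_one, hi']
    exact Matrix.map_one _ (map_zero _) (map_one _)
  | cons a L ih =>
    have e : prodAlong s t v (a :: L) = B s t v a * prodAlong s t v L := by
      simp [prodAlong]
    rw [e, Matrix.map_mul, ih, act_B]
    simp only [mul_assoc]
    rw [← mul_assoc (Matrix.map (ghi v g) _) (Matrix.map (gh v g) _), hi, one_mul]

theorem prodAlong_ne (L : List Q₁) (h : L ≠ []) (p q : V v) (hpq : prodAlong s t v L p q ≠ 0) :
    L.IsChain (fun x y => s x = t y) ∧ p.1 = t (L.head h) ∧ q.1 = s (L.getLast h) := by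
  induction L generalizing p with
  | nil => exact absurd rfl h
  | cons a L ih =>
    have e : prodAlong s t v (a :: L) = B s t v a * prodAlong s t v L := by
      simp [prodAlong]
    rw [e, Matrix.mul_apply] at hpq
    obtain ⟨r, _, hr⟩ := Finset.exists_ne_zero_of_sum_ne_zero hpq
    have h1 := left_ne_zero_of_mul hr
    have h2 := right_ne_zero_of_mul hr
    have h3 : p.1 = t a ∧ r.1 = s a := by
      by_contra h; exact h1 (B_ne _ _ _ _ _ _ h)
    by_cases hL : L = []
    · subst hL
      have : r = q := by
        by_contra hne
        exact h2 (by simp [prodAlong, hne])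
      subst this
      simp [h3]
    · obtain ⟨i1, i2, i3⟩ := ih hL r h2
      refine ⟨?_, h3.1, by rw [List.getLast_cons hL]; exact i3⟩
      obtain ⟨b, L', rfl⟩ := List.exists_cons_of_ne_nil hL
      refine List.isChain_cons_cons.2 ⟨?_, i1⟩
      rw [← h3.2, i2]; rfl

theorem easy (I : Set Q₀) (f : R s t v)
    (hf : f ∈ Algebra.adjoin ℂ (traceGens s t v I ∪ entryGens s t v I))
    (g : ∀ i : Q₀, GL (Fin (v i)) ℂ) (hg : ∀ i ∉ I, g i = 1) : act s t v g f = f := by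
  have hle : Algebra.adjoin ℂ (traceGens s t v I ∪ entryGens s t v I) ≤
      AlgHom.equalizer (act s t v g) (AlgHom.id ℂ _) := by
    apply Algebra.adjoin_le
    rintro f (⟨L, h, hc, -, -, rfl⟩ | ⟨L, h, p, q, hc, h1, h2, rfl⟩)
    · change act s t v g _ = _
      have hi : (ghi v g).map (MvPolynomial.C (σ := Var s t v)) *
          (gh v g).map MvPolynomial.C = 1 := by
        rw [← Matrix.map_mul, ghi_mul_gh, Matrix.map_one _ (map_zero _) (map_one _)]
      have e : act s t v g (Matrix.trace (prodAlong s t v L)) =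
          Matrix.trace ((prodAlong s t v L).map (act s t v g)) := by
        simp [Matrix.trace, map_sum]
      rw [e, act_prodAlong, Matrix.trace_mul_comm, ← mul_assoc, hi, one_mul]
      rfl
    · change act s t v g _ = prodAlong s t v L p q
      by_cases h0 : prodAlong s t v L p q = 0
      · rw [h0, map_zero]
      obtain ⟨-, i1, i2⟩ := prodAlong_ne s t v L h p q h0
      have hp : g p.1 = 1 := hg _ (by rwa [i1])
      have hq : g q.1 = 1 := hg _ (by rwa [i2])
      have e1 : ∀ x, gh v g p x = (1 : Matrix (V v) (V v) ℂ) p x := by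
        intro x
        rw [gh, Matrix.blockDiagonal'_apply, hp, ← Matrix.blockDiagonal'_one,
          Matrix.blockDiagonal'_apply]
        simp
      have e2 : ∀ x, ghi v g x q = (1 : Matrix (V v) (V v) ℂ) x q := by
        intro x
        obtain ⟨i, x⟩ := x
        obtain ⟨j, q⟩ := q
        by_cases hij : i = j
        · subst hij
          simp only at hq
          rw [ghi, Matrix.blockDiagonal'_apply_eq, hq, ← Matrix.blockDiagonal'_one,
            Matrix.blockDiagonal'_apply_eq]
          simp
        · rw [ghi_ne _ _ _ _ hij, Matrix.one_apply_ne]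
          intro h
          exact hij (congrArg Sigma.fst h)
      have := congrFun (congrFun (act_prodAlong s t v g L) p) q
      rw [Matrix.map_apply] at this
      rw [this]
      simp only [Matrix.mul_apply, Matrix.map_apply, e1, e2, Matrix.one_apply]
      simp
  exact hle hf

end Inv

section Deriv

open MvPolynomial

variable (s t : Q₁ → Q₀) (v : Q₀ → ℕ)

/-- Padded partial derivatives. -/
def Dp (a : Q₁) (x y : V v) : Derivation ℂ (R s t v) (R s t v) :=
  if h : x.1 = t a ∧ y.1 = s a then
    pderiv (mkVar s t v a (Fin.cast (congrArg v h.1) x.2) (Fin.cast (congrArg v h.2) y.2))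
  else 0

theorem Dp_ok (a : Q₁) (p : Fin (v (t a))) (q : Fin (v (s a))) :
    Dp s t v a ⟨t a, p⟩ ⟨s a, q⟩ = pderiv (mkVar s t v a p q) :=
  dif_pos (show t a = t a ∧ s a = s a from ⟨rfl, rfl⟩)

theorem Dp_ne (a : Q₁) (x y : V v) (h : ¬ (x.1 = t a ∧ y.1 = s a)) : Dp s t v a x y = 0 :=
  dif_neg h

open Classical in
theorem Dp_X (a : Q₁) (x y : V v) (a' : Q₁) (p : Fin (v (t a'))) (q : Fin (v (s a'))) :
    Dp s t v a x y (X (mkVar s t v a' p q)) =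
      if a = a' ∧ x = ⟨t a', p⟩ ∧ y = ⟨s a', q⟩ then 1 else 0 := by
  by_cases h : x.1 = t a ∧ y.1 = s a
  · obtain ⟨i, p'⟩ := x
    obtain ⟨j, q'⟩ := y
    obtain ⟨rfl, rfl⟩ := h
    rw [Dp_ok]
    by_cases h2 : mkVar s t v a' p q = mkVar s t v a p' q'
    · rw [h2, pderiv_X_self, if_pos]
      obtain ⟨rfl, h3⟩ := Sigma.mk.inj (show (⟨a', (p, q)⟩ :
        Σ a : Q₁, Fin (v (t a)) × Fin (v (s a))) = ⟨a, (p', q')⟩ from h2)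
      obtain ⟨rfl, rfl⟩ := Prod.mk.inj (eq_of_heq h3)
      exact ⟨rfl, rfl, rfl⟩
    · rw [pderiv_X_of_ne h2, if_neg]
      rintro ⟨rfl, h3, h4⟩
      obtain rfl := eq_of_heq (Sigma.mk.inj h3).2
      obtain rfl := eq_of_heq (Sigma.mk.inj h4).2
      exact h2 rfl
  · rw [Dp_ne _ _ _ _ _ _ h, if_neg]
    · rfl
    · rintro ⟨rfl, rfl, rfl⟩
      exact h ⟨rfl, rfl⟩

open Classical in
theorem Dp_B (a : Q₁) (x y : V v) (a' : Q₁) (x' y' : V v) :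
    Dp s t v a x y (B s t v a' x' y') =
      if x'.1 = t a' ∧ y'.1 = s a' then (if a = a' ∧ x = x' ∧ y = y' then 1 else 0) else 0 := by
  by_cases h : x'.1 = t a' ∧ y'.1 = s a'
  · obtain ⟨i, p'⟩ := x'
    obtain ⟨j, q'⟩ := y'
    obtain ⟨rfl, rfl⟩ := h
    rw [B_ok, Dp_X]
    exact (if_pos ⟨rfl, rfl⟩).symm
  · rw [if_neg h, B_ne _ _ _ _ _ _ h, map_zero]

theorem der_sum_apply {J A : Type*} [CommRing A] [Algebra ℂ A] (S : Finset J)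
    (D : J → Derivation ℂ A A) (x : A) : (∑ j ∈ S, D j) x = ∑ j ∈ S, D j x := by
  classical
  induction S using Finset.induction with
  | empty => simp
  | insert a S ha ih => rw [Finset.sum_insert ha, Finset.sum_insert ha, Derivation.add_apply, ih]

theorem euler (f : R s t v) (n : ℕ) (hf : f.IsHomogeneous n) :
    ∑ a, ∑ x, ∑ y, B s t v a x y * Dp s t v a x y f = n • f := by
  classical
  rw [← hf.sum_X_mul_pderiv]
  let D1 : Derivation ℂ (R s t v) (R s t v) := ∑ a, ∑ x, ∑ y, B s t v a x y • Dp s t v a x y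
  let D2 : Derivation ℂ (R s t v) (R s t v) := ∑ i, (X i : R s t v) • pderiv i
  have : D1 = D2 := by
    apply MvPolynomial.derivation_ext
    rintro ⟨a', p, q⟩
    change D1 (X (mkVar s t v a' p q)) = D2 (X (mkVar s t v a' p q))
    have e2 : D2 (X (mkVar s t v a' p q)) = X (mkVar s t v a' p q) := by
      simp only [D2, der_sum_apply, Derivation.coe_smul, Pi.smul_apply,
        smul_eq_mul]
      rw [Finset.sum_eq_single (mkVar s t v a' p q)]
      · simp
      · intro b _ hb
        rw [pderiv_X_of_ne hb.symm, mul_zero]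
      · simp
    rw [e2]
    simp only [D1, der_sum_apply, Derivation.coe_smul, Pi.smul_apply,
      smul_eq_mul, Dp_X, ite_and]
    simp [B_ok]
  have h := DFunLike.congr_fun this f
  simpa only [D1, D2, der_sum_apply, Derivation.coe_smul, Pi.smul_apply,
      smul_eq_mul] using h

theorem chain (g : ∀ i : Q₀, GL (Fin (v i)) ℂ) (a : Q₁) (x y : V v) (f : R s t v) :
    Dp s t v a x y (act s t v g f) =
      ∑ x', ∑ y', (gh v g x' x * ghi v g y y') • act s t v g (Dp s t v a x' y' f) := by
  classical
  induction f using MvPolynomial.induction_on with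
  | C c =>
    have h1 : ∀ x y, Dp s t v a x y (C c) = 0 := fun x y => (Dp s t v a x y).map_algebraMap c
    have h2 : act s t v g (C c) = C c := (act s t v g).commutes c
    simp [h1, h2]
  | add p q hp hq =>
    simp only [map_add, hp, hq, smul_add, Finset.sum_add_distrib]
  | mul_X f i hf =>
    obtain ⟨a', p, q⟩ := i
    change Dp s t v a x y (act s t v g (f * X (mkVar s t v a' p q))) =
      ∑ x', ∑ y', (gh v g x' x * ghi v g y y') •
        act s t v g (Dp s t v a x' y' (f * X (mkVar s t v a' p q)))
    have key : Dp s t v a x y (act s t v g (X (mkVar s t v a' p q))) =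
        ∑ x', ∑ y', (gh v g x' x * ghi v g y y') •
          act s t v g (Dp s t v a x' y' (X (mkVar s t v a' p q))) := by
      have h := congrFun (congrFun (act_B s t v g a') ⟨t a', p⟩) ⟨s a', q⟩
      rw [Matrix.map_apply, B_ok] at h
      rw [h]
      simp only [Matrix.mul_apply, Matrix.map_apply, Finset.sum_mul, map_sum, Dp_X]
      have e : ∀ x1 y1, Dp s t v a x y (C (gh v g ⟨t a', p⟩ y1) * B s t v a' y1 x1 *
          C (ghi v g x1 ⟨s a', q⟩)) = (gh v g ⟨t a', p⟩ y1 * ghi v g x1 ⟨s a', q⟩) •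
            if a = a' ∧ x = y1 ∧ y = x1 then 1 else 0 := by
        intro x1 y1
        have e0 : C (gh v g ⟨t a', p⟩ y1) * B s t v a' y1 x1 * C (ghi v g x1 ⟨s a', q⟩) =
            (gh v g ⟨t a', p⟩ y1 * ghi v g x1 ⟨s a', q⟩) • B s t v a' y1 x1 := by
          rw [MvPolynomial.smul_eq_C_mul, C_mul]; ring
        rw [e0, Derivation.map_smul, Dp_B]
        split_ifs with h1 h2 h2
        · rfl
        · rfl
        · rcases not_and_or.1 h1 with h1 | h1
          · rw [gh_ne _ _ _ _ (fun h => h1 h.symm)]; simp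
          · rw [ghi_ne _ _ _ _ h1]; simp
        · rfl
      simp only [e, ite_and]
      by_cases ha : a = a'
      · simp [ha, apply_ite (act s t v g)]
      · simp [ha]
    simp only [map_mul, Derivation.leibniz, hf, key, smul_eq_mul, map_add, smul_add,
      Finset.sum_add_distrib, Finset.mul_sum, mul_smul_comm]

/-- Taylor coefficients. -/
def cf : ∀ n : ℕ, (Fin n → Q₁) → (Fin n → V v) → (Fin n → V v) → (R s t v →ₗ[ℂ] ℂ)
  | 0, _, _, _ => MvPolynomial.lcoeff ℂ 0
  | n + 1, α, x, y =>
    cf n (fun k => α k.succ) (fun k => x k.succ) (fun k => y k.succ) ∘ₗ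
      (Dp s t v (α 0) (x 0) (y 0) : R s t v →ₗ[ℂ] R s t v)

theorem Dp_hom (a : Q₁) (x y : V v) (f : R s t v) (n : ℕ) (hf : f.IsHomogeneous (n + 1)) :
    (Dp s t v a x y f).IsHomogeneous n := by
  rw [Dp]
  split_ifs
  · exact hf.pderiv
  · exact isHomogeneous_zero _ _ _

theorem taylor (n : ℕ) (f : R s t v) (hf : f.IsHomogeneous n) :
    (n.factorial : ℂ) • f = ∑ α : Fin n → Q₁, ∑ x : Fin n → V v, ∑ y : Fin n → V v,
      cf s t v n α x y f • ∏ k, B s t v (α k) (x k) (y k) := by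
  induction n generalizing f with
  | zero =>
    have : f = C (coeff 0 f) := by
      rw [← totalDegree_eq_zero_iff_eq_C]
      exact Nat.le_zero.1 hf.totalDegree_le
    simp only [cf, Finset.univ_unique, Finset.sum_singleton, Finset.univ_eq_empty,
      Finset.prod_empty]
    conv_lhs => rw [this]
    simp [MvPolynomial.smul_eq_C_mul]
  | succ n ih =>
    have h := euler s t v f (n + 1) hf
    rw [Nat.factorial_succ, Nat.cast_mul, mul_comm, mul_smul, Nat.cast_smul_eq_nsmul ℂ (n + 1), ← h]
    simp only [Finset.smul_sum, ← mul_smul_comm]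
    simp only [sum_fin_cons (β := Q₁), sum_fin_cons (β := V v)]
    refine Finset.sum_congr rfl fun a _ => ?_
    have e : ∀ x y : V v, B s t v a x y * ((n.factorial : ℂ) • Dp s t v a x y f) =
        ∑ α : Fin n → Q₁, ∑ x' : Fin n → V v, ∑ y' : Fin n → V v,
          cf s t v (n + 1) (Fin.cons a α) (Fin.cons x x') (Fin.cons y y') f •
            ∏ k, B s t v ((Fin.cons a α : Fin (n + 1) → Q₁) k)
              ((Fin.cons x x' : Fin (n + 1) → V v) k) ((Fin.cons y y' : Fin (n + 1) → V v) k) := by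
      intro x y
      rw [ih _ (Dp_hom s t v a x y f n hf)]
      simp only [Finset.mul_sum, Fin.prod_univ_succ, Fin.cons_zero, Fin.cons_succ, mul_smul_comm]
      rfl
    simp only [e]
    -- reorder the sums
    have r1 : ∀ (G : V v → V v → (Fin n → Q₁) → (Fin n → V v) → (Fin n → V v) → R s t v),
        ∑ x, ∑ y, ∑ α, ∑ x', ∑ y', G x y α x' y' = ∑ α, ∑ x, ∑ x', ∑ y, ∑ y', G x y α x' y' := by
      intro G
      calc _ = ∑ x, ∑ α, ∑ y, ∑ x', ∑ y', G x y α x' y' :=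
            Finset.sum_congr rfl fun x _ => Finset.sum_comm
        _ = ∑ α, ∑ x, ∑ y, ∑ x', ∑ y', G x y α x' y' := Finset.sum_comm
        _ = _ := Finset.sum_congr rfl fun α _ => Finset.sum_congr rfl fun x _ => Finset.sum_comm
    exact r1 _

theorem cf_act (g : ∀ i : Q₀, GL (Fin (v i)) ℂ) (n : ℕ) (α : Fin n → Q₁) (x y : Fin n → V v)
    (f : R s t v) :
    cf s t v n α x y (act s t v g f) = ∑ x', ∑ y',
      (kron (fun _ => gh v g) x' x * kron (fun _ => ghi v g) y y') * cf s t v n α x' y' f := by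
  induction n generalizing f with
  | zero =>
    simp only [cf, Finset.univ_unique, Finset.sum_singleton, kron_apply, Finset.univ_eq_empty,
      Finset.prod_empty, one_mul, MvPolynomial.lcoeff_apply]
    change constantCoeff (act s t v g f) = constantCoeff f
    induction f using MvPolynomial.induction_on with
    | C c =>
      have h2 : act s t v g (C c) = C c := (act s t v g).commutes c
      rw [h2]
    | add p q hp hq => simp only [map_add, hp, hq]
    | mul_X f i hf =>
      obtain ⟨a', p, q⟩ := i
      change constantCoeff (act s t v g (f * X (mkVar s t v a' p q))) =
        constantCoeff (f * X (mkVar s t v a' p q))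
      rw [map_mul, map_mul, map_mul, act_X]
      simp
  | succ n ih =>
    have e : cf s t v (n + 1) α x y (act s t v g f) =
        cf s t v n (fun k => α k.succ) (fun k => x k.succ) (fun k => y k.succ)
          (Dp s t v (α 0) (x 0) (y 0) (act s t v g f)) := rfl
    rw [e, chain]
    simp only [map_sum, map_smul, ih, sum_fin_cons (β := V v), smul_eq_mul, Finset.mul_sum]
    refine Finset.sum_congr rfl fun x0 _ => ?_
    rw [Finset.sum_comm]
    refine Finset.sum_congr rfl fun x1 _ => ?_
    refine Finset.sum_congr rfl fun y0 _ => Finset.sum_congr rfl fun y1 _ => ?_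
    simp only [kron_apply, Fin.prod_univ_succ, Fin.cons_zero, Fin.cons_succ]
    have e2 : cf s t v (n + 1) α (Fin.cons x0 x1) (Fin.cons y0 y1) f =
        cf s t v n (fun k => α k.succ) x1 y1 (Dp s t v (α 0) x0 y0 f) := rfl
    rw [e2]
    ring

end Deriv

section Alg

open Classical in
/-- Block idempotent. -/
def eI (v : Q₀ → ℕ) (i : Q₀) : Matrix (V v) (V v) ℂ :=
  Matrix.diagonal fun x => if x.1 = i then 1 else 0

/-- Generators of the commutant of the group in one tensor factor. -/
def Cgen (v : Q₀ → ℕ) (I : Set Q₀) : Set (Matrix (V v) (V v) ℂ) :=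
  {c | (∃ i ∈ I, c = eI v i) ∨ ∃ x y : V v, x.1 ∉ I ∧ y.1 ∉ I ∧ c = Matrix.single x y 1}

/-- Commutant of the group in one tensor factor. -/
def Csub (v : Q₀ → ℕ) (I : Set Q₀) : Submodule ℂ (Matrix (V v) (V v) ℂ) :=
  Submodule.span ℂ (Cgen v I)

/-- Linear span of the group in one tensor factor. -/
def Csub' (v : Q₀ → ℕ) (I : Set Q₀) : Submodule ℂ (Matrix (V v) (V v) ℂ) where
  carrier := {A | (∀ x y : V v, x.1 ≠ y.1 → A x y = 0) ∧
    ∃ l : ℂ, ∀ x y : V v, x.1 ∉ I → y.1 ∉ I → A x y = l * (1 : Matrix (V v) (V v) ℂ) x y}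
  add_mem' := by
    rintro A A' ⟨h1, l, h2⟩ ⟨h1', l', h2'⟩
    refine ⟨fun x y h => by simp [h1 x y h, h1' x y h], l + l', fun x y hx hy => ?_⟩
    rw [Matrix.add_apply, h2 x y hx hy, h2' x y hx hy, add_mul]
  zero_mem' := ⟨fun _ _ _ => rfl, 0, fun _ _ _ _ => by simp⟩
  smul_mem' := by
    rintro r A ⟨h1, l, h2⟩
    refine ⟨fun x y h => by simp [h1 x y h], r * l, fun x y hx hy => ?_⟩
    rw [Matrix.smul_apply, h2 x y hx hy, smul_eq_mul, mul_assoc]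

variable (v : Q₀ → ℕ) (I : Set Q₀)

theorem eI_mul_eI (i j : Q₀) : eI v i * eI v j = if i = j then eI v i else 0 := by
  rw [eI, eI, Matrix.diagonal_mul_diagonal]
  split_ifs with h
  · subst h; simp
  · rw [← Matrix.diagonal_zero]
    congr 1
    funext x
    by_cases hx : x.1 = i
    · simp [hx, h]
    · simp [hx]

theorem Csub_mul (a : Matrix (V v) (V v) ℂ) (ha : a ∈ Csub v I) (b : Matrix (V v) (V v) ℂ)
    (hb : b ∈ Csub v I) : a * b ∈ Csub v I := by
  classical
  induction ha, hb using Submodule.span_induction₂ with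
  | mem_mem x y hx hy =>
    rcases hx with ⟨i, hi, rfl⟩ | ⟨x, y, hx, hy', rfl⟩
    · rcases hy with ⟨j, hj, rfl⟩ | ⟨x', y', hx', hy', rfl⟩
      · rw [eI_mul_eI]
        split_ifs
        · exact Submodule.subset_span (Or.inl ⟨i, hi, rfl⟩)
        · exact zero_mem _
      · have : eI v i * Matrix.single x' y' (1 : ℂ) = 0 := by
          ext p q
          rw [eI, Matrix.diagonal_mul, Matrix.single_apply, Matrix.zero_apply]
          split_ifs with h1 h2 h2
          · exact absurd (by rw [h2.1, h1]; exact hi) hx'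
          all_goals simp
        rw [this]; exact zero_mem _
    · rcases hy with ⟨j, hj, rfl⟩ | ⟨x', y', hx', hy', rfl⟩
      · have : Matrix.single x y (1 : ℂ) * eI v j = 0 := by
          ext p q
          rw [eI, Matrix.mul_diagonal, Matrix.single_apply, Matrix.zero_apply]
          split_ifs with h1 h2 h2
          · exact absurd (by rw [h1.2, h2]; exact hj) hy'
          all_goals simp
        rw [this]; exact zero_mem _
      · by_cases h : y = x'
        · subst h
          rw [Matrix.single_mul_single_same, one_mul]
          exact Submodule.subset_span (Or.inr ⟨x, y', hx, hy', rfl⟩)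
        · rw [Matrix.single_mul_single_of_ne _ _ _ _ h]
          exact zero_mem _
  | zero_left => simp
  | zero_right => simp
  | add_left x y z _ _ _ h h' => rw [add_mul]; exact add_mem h h'
  | add_right x y z _ _ _ h h' => rw [mul_add]; exact add_mem h h'
  | smul_left r x y _ _ h => rw [smul_mul_assoc]; exact Submodule.smul_mem _ _ h
  | smul_right r x y _ _ h => rw [mul_smul_comm]; exact Submodule.smul_mem _ _ h

theorem Csub_star (a : Matrix (V v) (V v) ℂ) (ha : a ∈ Csub v I) : aᴴ ∈ Csub v I := by
  classical
  induction ha using Submodule.span_induction with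
  | mem x hx =>
    apply Submodule.subset_span
    rcases hx with ⟨i, hi, rfl⟩ | ⟨x, y, hx, hy, rfl⟩
    · refine Or.inl ⟨i, hi, ?_⟩
      rw [eI, Matrix.diagonal_conjTranspose]
      congr 1
      funext x
      simp [apply_ite]
    · refine Or.inr ⟨y, x, hy, hx, ?_⟩
      simp [Matrix.conjTranspose_single]
  | zero => simp
  | add x y _ _ h h' => rw [Matrix.conjTranspose_add]; exact add_mem h h'
  | smul r x _ h => rw [Matrix.conjTranspose_smul]; exact Submodule.smul_mem _ _ h

open Classical in
/-- Left half of the separability element. -/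
def uu : Q₀ ⊕ (V v × V v) → Matrix (V v) (V v) ℂ
  | Sum.inl i => if i ∈ I then eI v i else 0
  | Sum.inr (x, y) => if x.1 ∉ I ∧ y.1 ∉ I then Matrix.single x y 1 else 0

open Classical in
/-- Number of frozen indices. -/
def frz : ℕ := (Finset.univ.filter fun y : V v => y.1 ∉ I).card

open Classical in
/-- Right half of the separability element. -/
def ww : Q₀ ⊕ (V v × V v) → Matrix (V v) (V v) ℂ
  | Sum.inl i => if i ∈ I then eI v i else 0
  | Sum.inr (x, y) => if x.1 ∉ I ∧ y.1 ∉ I then ((frz v I : ℂ)⁻¹) • Matrix.single y x 1 else 0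

theorem uu_mem (j) : uu v I j ∈ Csub v I := by
  classical
  rcases j with i | ⟨x, y⟩
  · rw [uu]; split_ifs with h
    · exact Submodule.subset_span (Or.inl ⟨i, h, rfl⟩)
    · exact zero_mem _
  · rw [uu]; split_ifs with h
    · exact Submodule.subset_span (Or.inr ⟨x, y, h.1, h.2, rfl⟩)
    · exact zero_mem _

theorem ww_mem (j) : ww v I j ∈ Csub v I := by
  classical
  rcases j with i | ⟨x, y⟩
  · rw [ww]; split_ifs with h
    · exact Submodule.subset_span (Or.inl ⟨i, h, rfl⟩)
    · exact zero_mem _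
  · rw [ww]; split_ifs with h
    · exact Submodule.smul_mem _ _ (Submodule.subset_span (Or.inr ⟨y, x, h.2, h.1, rfl⟩))
    · exact zero_mem _

open Classical in
theorem uAw (A : Matrix (V v) (V v) ℂ) (p q : V v) :
    (∑ j, uu v I j * A * ww v I j) p q =
      (if p.1 ∈ I ∧ p.1 = q.1 then A p q else 0) +
      (if p.1 ∉ I ∧ p = q then
        (frz v I : ℂ)⁻¹ * ∑ y ∈ Finset.univ.filter (fun y : V v => y.1 ∉ I), A y y else 0) := by
  rw [Fintype.sum_sum_type, Matrix.add_apply, Matrix.sum_apply, Matrix.sum_apply]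
  congr 1
  · have : ∀ i, (uu v I (Sum.inl i) * A * ww v I (Sum.inl i)) p q =
        if i = p.1 then (if p.1 ∈ I ∧ p.1 = q.1 then A p q else 0) else 0 := by
      intro i
      rw [uu, ww]
      by_cases hi : i ∈ I
      · rw [if_pos hi, eI, Matrix.mul_diagonal, Matrix.diagonal_mul]
        by_cases h1 : p.1 = i
        · subst h1
          by_cases h2 : q.1 = p.1
          · simp [hi, h2]
          · have h2' : ¬ p.1 = q.1 := fun h => h2 h.symm
            simp [h2, h2']
        · have h1' : ¬ i = p.1 := fun h => h1 h.symm
          simp [h1, h1']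
      · rw [if_neg hi]
        by_cases h1 : i = p.1
        · subst h1; simp [hi]
        · simp [h1]
    simp [this]
  · have : ∀ x y, (uu v I (Sum.inr (x, y)) * A * ww v I (Sum.inr (x, y))) p q =
        if x = p then (if p.1 ∉ I ∧ p = q then (if y.1 ∉ I then
          (frz v I : ℂ)⁻¹ * A y y else 0) else 0) else 0 := by
      intro x y
      rw [uu, ww]
      by_cases hx : x.1 ∉ I ∧ y.1 ∉ I
      · rw [if_pos hx, if_pos hx, Matrix.mul_smul, Matrix.single_mul_mul_single,
          Matrix.smul_apply, Matrix.single_apply]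
        by_cases h1 : x = p
        · subst h1
          by_cases h2 : x = q
          · simp [hx, h2]
            intro h; exact absurd (h2 ▸ h) hx.1
          · simp [h2]
        · simp [h1]
      · rw [if_neg hx]
        by_cases h1 : x = p
        · subst h1
          by_cases h3 : x.1 ∈ I
          · simp [h3]
          · have : y.1 ∈ I := by
              by_contra h; exact hx ⟨h3, h⟩
            simp [this]
        · simp [h1]
    rw [Fintype.sum_prod_type]
    simp only [this]
    rw [Finset.sum_comm]
    simp only [Finset.sum_ite_eq', Finset.mem_univ, if_true]
    split_ifs
    · rw [Finset.mul_sum, Finset.sum_filter]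
    · simp

theorem uw_one : ∑ j, uu v I j * ww v I j = 1 := by
  classical
  have h : ∑ j, uu v I j * ww v I j = ∑ j, uu v I j * 1 * ww v I j := by simp
  rw [h]
  ext p q
  rw [uAw]
  by_cases hpq : p = q
  · subst hpq
    by_cases hp : p.1 ∈ I
    · simp [hp]
    · have : (frz v I : ℂ) ≠ 0 := by
        rw [Nat.cast_ne_zero, frz]
        exact Finset.card_ne_zero_of_mem (a := p) (by simp [hp])
      simp only [hp, Matrix.one_apply_eq, false_and, if_false, not_false_eq_true, and_self, if_true,
        Finset.sum_const, zero_add, nsmul_eq_mul, mul_one]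
      exact inv_mul_cancel₀ this
  · simp [hpq]

theorem one_mem_Csub : (1 : Matrix (V v) (V v) ℂ) ∈ Csub v I := by
  rw [← uw_one v I]
  exact Submodule.sum_mem _ fun j _ => Csub_mul v I _ (uu_mem v I j) _ (ww_mem v I j)

theorem uAw_mem (A : Matrix (V v) (V v) ℂ) : ∑ j, uu v I j * A * ww v I j ∈ Csub' v I := by
  classical
  refine ⟨fun x y hxy => ?_,
    (frz v I : ℂ)⁻¹ * ∑ y ∈ Finset.univ.filter (fun y : V v => y.1 ∉ I), A y y,
    fun x y hx hy => ?_⟩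
  · rw [uAw]
    have hne : x ≠ y := fun h => hxy (congrArg _ h)
    simp [hxy, hne]
  · rw [uAw]
    simp only [hx, false_and, if_false, zero_add, not_false_eq_true, true_and, Matrix.one_apply]
    split_ifs <;> simp

/-- Density: commuting with the group implies commuting with its linear span. -/
theorem comm_span (n : ℕ) (F : Matrix (Fin n → V v) (Fin n → V v) ℂ)
    (hF : ∀ g : ∀ i : Q₀, GL (Fin (v i)) ℂ, (∀ i ∉ I, g i = 1) →
      F * kron (fun _ => gh v g) = kron (fun _ => gh v g) * F)
    (A : Matrix (V v) (V v) ℂ) (hA : A ∈ Csub' v I) :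
    F * kron (fun _ => A) = kron (fun _ => A) * F := by
  classical
  obtain ⟨h1, l, h2⟩ := hA
  let a : ∀ i, Matrix (Fin (v i)) (Fin (v i)) ℂ := fun i => Matrix.of fun p q => A ⟨i, p⟩ ⟨i, q⟩
  let bad : Set ℂ := {-l} ∪ ⋃ i, {z | (-(a i)).charpoly.IsRoot z}
  have hbad : bad.Finite := by
    refine (Set.finite_singleton _).union (Set.finite_iUnion fun i => ?_)
    exact Polynomial.finite_setOfPred_isRoot (Matrix.charpoly_monic _).ne_zero
  have hdense : Dense badᶜ := by
    have := (dense_univ (X := ℂ)).sdiff_finite hbad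
    rwa [← Set.compl_eq_univ_sdiff] at this
  have key : ∀ z ∈ badᶜ, F * kron (fun _ => A + z • 1) = kron (fun _ => A + z • 1) * F := by
    intro z hz
    have hl : l + z ≠ 0 := by
      intro h
      exact hz (Or.inl (by rw [Set.mem_singleton_iff]; linear_combination h))
    have hdet : ∀ i, (a i + z • 1).det ≠ 0 := by
      intro i h
      refine hz (Or.inr (Set.mem_iUnion.2 ⟨i, ?_⟩))
      rw [Set.mem_ofPred_eq, Polynomial.IsRoot.def, Matrix.eval_charpoly, ← h]
      congr 1
      rw [sub_neg_eq_add, add_comm, Matrix.scalar_apply, Matrix.smul_one_eq_diagonal]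
    let g : ∀ i : Q₀, GL (Fin (v i)) ℂ := fun i => if i ∈ I then
      Matrix.GeneralLinearGroup.mkOfDetNeZero ((l + z)⁻¹ • (a i + z • 1)) (by
        rw [Matrix.det_smul]
        exact mul_ne_zero (pow_ne_zero _ (inv_ne_zero hl)) (hdet i)) else 1
    have hg : ∀ i ∉ I, g i = 1 := fun i hi => if_neg hi
    have hAg : A + z • 1 = (l + z) • gh v g := by
      ext ⟨i, p⟩ ⟨j, q⟩
      by_cases hij : i = j
      · subst hij
        rw [Matrix.smul_apply, gh, Matrix.blockDiagonal'_apply_eq]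
        have hone : (1 : Matrix (V v) (V v) ℂ) ⟨i, p⟩ ⟨i, q⟩ =
            (1 : Matrix (Fin (v i)) (Fin (v i)) ℂ) p q := by
          rw [Matrix.one_apply, Matrix.one_apply]
          simp
        by_cases hi : i ∈ I
        · have : (g i).val = (l + z)⁻¹ • (a i + z • 1) := by
            simp only [g, if_pos hi]; rfl
          rw [this, Matrix.smul_apply, smul_smul, mul_inv_cancel₀ hl, one_smul]
          simp only [Matrix.add_apply, Matrix.smul_apply, hone]
          rfl
        · rw [hg i hi, Matrix.add_apply, h2 _ _ hi hi, hone, Matrix.smul_apply, hone]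
          simp [add_mul]
      · rw [Matrix.smul_apply, gh_ne _ _ _ _ hij, Matrix.add_apply, h1 _ _ hij, Matrix.smul_apply,
          Matrix.one_apply_ne fun h => hij (congrArg Sigma.fst h)]
        simp
    rw [hAg, kron_smul (fun _ : Fin n => l + z) (fun _ => gh v g), mul_smul_comm, smul_mul_assoc,
      hF g hg]
  have hcont : ∀ y x, Continuous fun z : ℂ => kron (fun _ : Fin n => A + z • 1) y x := by
    intro y x
    simp only [kron_apply, Matrix.add_apply, Matrix.smul_apply]
    fun_prop
  have hall : ∀ z : ℂ, F * kron (fun _ => A + z • 1) = kron (fun _ => A + z • 1) * F := by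
    intro z
    ext y x
    have e : (fun z : ℂ => (F * kron (fun _ : Fin n => A + z • (1 : Matrix (V v) (V v) ℂ)) :
          Matrix (Fin n → V v) (Fin n → V v) ℂ) y x) =
        fun z : ℂ => (kron (fun _ : Fin n => A + z • (1 : Matrix (V v) (V v) ℂ)) * F :
          Matrix (Fin n → V v) (Fin n → V v) ℂ) y x := by
      apply Continuous.ext_on hdense
      · simp only [Matrix.mul_apply]
        exact continuous_finsetSum _ fun w _ => continuous_const.mul (hcont _ _)
      · simp only [Matrix.mul_apply]
        exact continuous_finsetSum _ fun w _ => (hcont _ _).mul continuous_const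
      · intro z hz
        simp only [key z hz]
    exact congrFun e z
  simpa using hall 0

end Alg

section Final

variable (s t : Q₁ → Q₀) (v : Q₀ → ℕ) (I : Set Q₀)

/-- The algebra of the theorem. -/
abbrev SA : Subalgebra ℂ (R s t v) := Algebra.adjoin ℂ (traceGens s t v I ∪ entryGens s t v I)

theorem prodAlong_append (L L' : List Q₁) :
    prodAlong s t v (L ++ L') = prodAlong s t v L * prodAlong s t v L' := by
  simp [prodAlong]

theorem entry_mem (L : List Q₁) (h : L ≠ []) (x y : V v) (hx : x.1 ∉ I) (hy : y.1 ∉ I) :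
    prodAlong s t v L x y ∈ SA s t v I := by
  by_cases h0 : prodAlong s t v L x y = 0
  · rw [h0]; exact zero_mem _
  obtain ⟨i1, i2, i3⟩ := prodAlong_ne s t v L h x y h0
  exact Algebra.subset_adjoin (Or.inr ⟨L, h, x, y, i1, i3 ▸ hy, i2 ▸ hx, rfl⟩)

theorem chain_t (a : Q₁) (L : List Q₁) (hc : (a :: L).IsChain (fun x y => s x = t y))
    (hs : ∀ b ∈ a :: L, s b ∈ I) : ∀ b ∈ L, t b ∈ I := by
  induction L generalizing a with
  | nil => simp
  | cons c L ih =>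
    rw [List.isChain_cons_cons] at hc
    intro b hb
    rcases List.mem_cons.1 hb with rfl | hb
    · rw [← hc.1]; exact hs a (by simp)
    · exact ih c hc.2 (fun b hb => hs b (List.mem_cons_of_mem _ hb)) b hb

theorem trace_mem (L : List Q₁) (h : L ≠ []) (hs : ∀ a ∈ L, s a ∈ I) :
    Matrix.trace (prodAlong s t v L) ∈ SA s t v I := by
  by_cases h0 : Matrix.trace (prodAlong s t v L) = 0
  · rw [h0]; exact zero_mem _
  obtain ⟨p, _, hp⟩ := Finset.exists_ne_zero_of_sum_ne_zero h0
  obtain ⟨i1, i2, i3⟩ := prodAlong_ne s t v L h p p hp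
  refine Algebra.subset_adjoin (Or.inl ⟨L, h, i1, by rw [← i2, i3], fun a ha => ⟨hs a ha, ?_⟩, rfl⟩)
  have hl : s (L.getLast h) ∈ I := hs _ (List.getLast_mem h)
  obtain ⟨b, L', rfl⟩ := List.exists_cons_of_ne_nil h
  rcases List.mem_cons.1 ha with rfl | ha
  · have : t a = s ((a :: L').getLast h) := by rw [← i3, i2]; rfl
    rw [this]; exact hl
  · exact chain_t s t I b L' i1 hs a ha

/-- Generators of the matrix space closed under products with traces in the algebra. -/
def Ygen : Set (Matrix (V v) (V v) (R s t v)) :=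
  {Y | (∃ L : List Q₁, L ≠ [] ∧ (∀ a ∈ L, s a ∈ I) ∧ Y = prodAlong s t v L) ∨
    ∃ r ∈ SA s t v I, ∃ L1 L2 : List Q₁, L1 ≠ [] ∧ ∃ x y : V v, x.1 ∉ I ∧ y.1 ∉ I ∧
      Y = Matrix.of fun p q => r * (prodAlong s t v L1 p x * prodAlong s t v L2 y q)}

/-- Matrix space closed under products with traces in the algebra. -/
def Ysub : Submodule ℂ (Matrix (V v) (V v) (R s t v)) := Submodule.span ℂ (Ygen s t v I)

theorem Ysub_mul (a : Matrix (V v) (V v) (R s t v)) (ha : a ∈ Ysub s t v I)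
    (b : Matrix (V v) (V v) (R s t v)) (hb : b ∈ Ysub s t v I) : a * b ∈ Ysub s t v I := by
  induction ha, hb using Submodule.span_induction₂ with
  | mem_mem x y hx hy =>
    apply Submodule.subset_span
    rcases hx with ⟨L, h, hs, rfl⟩ | ⟨r, hr, L1, L2, h, x, y, hx, hy', rfl⟩
    · rcases hy with ⟨L', h', hs', rfl⟩ | ⟨r', hr', L1', L2', h', x', y', hx', hy', rfl⟩
      · refine Or.inl ⟨L ++ L', by simp [h], ?_, (prodAlong_append s t v L L').symm⟩
        intro a ha
        rcases List.mem_append.1 ha with ha | ha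
        · exact hs a ha
        · exact hs' a ha
      · refine Or.inr ⟨r', hr', L ++ L1', L2', by simp [h], x', y', hx', hy', ?_⟩
        ext1 p q
        simp only [Matrix.mul_apply, Matrix.of_apply, prodAlong_append, Finset.sum_mul,
          Finset.mul_sum]
        exact Finset.sum_congr rfl fun z _ => by ring
    · rcases hy with ⟨L', h', hs', rfl⟩ | ⟨r', hr', L1', L2', h', x', y', hx', hy'', rfl⟩
      · refine Or.inr ⟨r, hr, L1, L2 ++ L', h, x, y, hx, hy', ?_⟩
        ext1 p q
        simp only [Matrix.mul_apply, Matrix.of_apply, prodAlong_append, Finset.sum_mul,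
          Finset.mul_sum]
        exact Finset.sum_congr rfl fun z _ => by ring
      · refine Or.inr ⟨r * r' * prodAlong s t v (L2 ++ L1') y x', mul_mem (mul_mem hr hr')
          (entry_mem s t v I _ (by simp [h']) _ _ hy' hx'), L1, L2', h, x, y', hx, hy'', ?_⟩
        ext1 p q
        simp only [Matrix.mul_apply, Matrix.of_apply, prodAlong_append, Finset.sum_mul,
          Finset.mul_sum]
        exact Finset.sum_congr rfl fun z _ => by ring
  | zero_left => simp
  | zero_right => simp
  | add_left x y z _ _ _ h h' => rw [add_mul]; exact add_mem h h'
  | add_right x y z _ _ _ h h' => rw [mul_add]; exact add_mem h h'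
  | smul_left r x y _ _ h => rw [smul_mul_assoc]; exact Submodule.smul_mem _ _ h
  | smul_right r x y _ _ h => rw [mul_smul_comm]; exact Submodule.smul_mem _ _ h

theorem Ysub_trace (a : Matrix (V v) (V v) (R s t v)) (ha : a ∈ Ysub s t v I) :
    a.trace ∈ SA s t v I := by
  induction ha using Submodule.span_induction with
  | mem x hx =>
    rcases hx with ⟨L, h, hs, rfl⟩ | ⟨r, hr, L1, L2, h, x, y, hx, hy, rfl⟩
    · exact trace_mem s t v I L h hs
    · have : Matrix.trace (Matrix.of fun p q =>
          r * (prodAlong s t v L1 p x * prodAlong s t v L2 y q)) =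
          r * prodAlong s t v (L2 ++ L1) y x := by
        simp only [Matrix.trace, Matrix.diag_apply, Matrix.of_apply, prodAlong_append,
          Matrix.mul_apply, Finset.mul_sum]
        exact Finset.sum_congr rfl fun z _ => by ring
      rw [this]
      exact mul_mem hr (entry_mem s t v I _ (by simp [h]) _ _ hy hx)
  | zero => rw [Matrix.trace_zero]; exact zero_mem _
  | add x y _ _ h h' => rw [Matrix.trace_add]; exact add_mem h h'
  | smul r x _ h => rw [Matrix.trace_smul]; exact Subalgebra.smul_mem _ h r

theorem B_mul_mem (a : Q₁) (c : Matrix (V v) (V v) ℂ) (hc : c ∈ Csub v I) :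
    B s t v a * c.map (MvPolynomial.C (σ := Var s t v)) ∈ Ysub s t v I := by
  classical
  induction hc using Submodule.span_induction with
  | mem x hx =>
    rcases hx with ⟨i, hi, rfl⟩ | ⟨x, y, hx, hy, rfl⟩
    · rw [eI, Matrix.diagonal_map (map_zero _)]
      by_cases h : s a = i
      · have : B s t v a * Matrix.diagonal (fun m : V v =>
            MvPolynomial.C (σ := Var s t v) (if m.1 = i then (1 : ℂ) else 0)) =
            prodAlong s t v [a] := by
          ext1 p q
          rw [Matrix.mul_diagonal]
          simp only [prodAlong, List.map_cons, List.map_nil, List.prod_cons, List.prod_nil, mul_one]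
          by_cases hq : q.1 = i
          · simp [hq]
          · rw [B_ne _ _ _ _ _ _ (fun hh => hq (hh.2.trans h)), zero_mul]
        refine Submodule.subset_span (Or.inl ⟨[a], by simp, by simp [h, hi], this⟩)
      · have : B s t v a * Matrix.diagonal (fun m : V v =>
            MvPolynomial.C (σ := Var s t v) (if m.1 = i then (1 : ℂ) else 0)) = 0 := by
          ext1 p q
          rw [Matrix.mul_diagonal]
          by_cases hq : q.1 = i
          · rw [B_ne _ _ _ _ _ _ (fun hh => h (hh.2.symm.trans hq)), zero_mul]; rfl
          · simp [hq]
        exact this ▸ zero_mem (Ysub s t v I)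
    · refine Submodule.subset_span (Or.inr ⟨1, one_mem _, [a], [], by simp, x, y, hx, hy, ?_⟩)
      ext1 p q
      simp only [prodAlong, List.map_cons, List.map_nil, List.prod_cons, List.prod_nil, mul_one,
        Matrix.of_apply, one_mul, Matrix.mul_apply, Matrix.map_apply, Matrix.single_apply,
        Matrix.one_apply]
      rw [Finset.sum_eq_single x]
      · by_cases hq : y = q <;> simp [hq]
      · intro b _ hb
        simp [hb.symm]
      · simp
  | zero =>
    rw [Matrix.map_zero _ (map_zero _), mul_zero]; exact zero_mem _
  | add x y _ _ h h' =>
    rw [Matrix.map_add _ (map_add _), mul_add]; exact add_mem h h'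
  | smul r x _ h =>
    have : (r • x).map (MvPolynomial.C (σ := Var s t v)) =
        r • x.map (MvPolynomial.C (σ := Var s t v)) := by
      ext1 p q
      simp [MvPolynomial.smul_eq_C_mul]
    rw [this, mul_smul_comm]; exact Submodule.smul_mem _ _ h

theorem contract_mem (n : ℕ) (α : Fin n → Q₁) (N : Matrix (Fin n → V v) (Fin n → V v) ℂ)
    (hN : N ∈ Submodule.span ℂ {d | ∃ (σ : Equiv.Perm (Fin n)) (c : Fin n → Matrix (V v) (V v) ℂ),
      (∀ k, c k ∈ Csub v I) ∧ d = dmat σ c}) :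
    ∑ x, ∑ y, N y x • ∏ k, B s t v (α k) (x k) (y k) ∈ SA s t v I := by
  classical
  induction hN using Submodule.span_induction with
  | mem d hd =>
    obtain ⟨σ, c, hc, rfl⟩ := hd
    have e : ∑ x, ∑ y, dmat σ c y x • ∏ k, B s t v (α k) (x k) (y k) =
        ∑ x : Fin n → V v, ∏ k, (B s t v (α k) *
          (c k).map (MvPolynomial.C (σ := Var s t v))) (x k) (x (σ k)) := by
      refine Finset.sum_congr rfl fun x _ => ?_
      simp only [Matrix.mul_apply]
      rw [Finset.prod_univ_sum, Fintype.piFinset_univ]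
      refine Finset.sum_congr rfl fun y _ => ?_
      rw [dmat_apply, kron_apply, MvPolynomial.smul_eq_C_mul, map_prod, ← Finset.prod_mul_distrib]
      exact Finset.prod_congr rfl fun k _ => mul_comm _ _
    rw [e]
    exact perm_trace (SA s t v I).toSubmonoid (Ysub s t v I) (Ysub_mul s t v I)
      (Ysub_trace s t v I) n σ _ fun k => B_mul_mem s t v I _ _ (hc k)
  | zero => simp
  | add x y _ _ h h' =>
    simp only [Matrix.add_apply, add_smul, Finset.sum_add_distrib]
    exact add_mem h h'
  | smul r x _ h =>
    simp only [Matrix.smul_apply, smul_assoc, ← Finset.smul_sum]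
    exact Subalgebra.smul_mem _ h r

theorem hom_case (n : ℕ) (f : R s t v) (hf : f.IsHomogeneous n)
    (hinv : ∀ g : ∀ i : Q₀, GL (Fin (v i)) ℂ, (∀ i ∉ I, g i = 1) → act s t v g f = f) :
    f ∈ SA s t v I := by
  have hn : (n.factorial : ℂ) ≠ 0 := Nat.cast_ne_zero.2 n.factorial_ne_zero
  have key : (n.factorial : ℂ) • f ∈ SA s t v I := by
    rw [taylor s t v n f hf]
    refine Subalgebra.sum_mem _ fun α _ => ?_
    let N : Matrix (Fin n → V v) (Fin n → V v) ℂ := Matrix.of fun y x => cf s t v n α x y f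
    apply contract_mem s t v I n α N
    apply schurWeyl (Csub v I) (Csub' v I) (one_mem_Csub v I) (Csub_mul v I) (Csub_star v I)
      (uu v I) (ww v I) (uu_mem v I) (ww_mem v I) (uw_one v I) (uAw_mem v I)
    apply comm_span
    intro g hg
    have e : N = kron (fun _ => ghi v g) * N * kron (fun _ => gh v g) := by
      ext1 y x
      have h := cf_act s t v g n α x y f
      rw [hinv g hg] at h
      change cf s t v n α x y f = _
      rw [h, Matrix.mul_apply]
      refine Finset.sum_congr rfl fun x' _ => ?_
      rw [Matrix.mul_apply, Finset.sum_mul]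
      refine Finset.sum_congr rfl fun y' _ => ?_
      change _ = kron (fun _ => ghi v g) y y' * cf s t v n α x' y' f * kron (fun _ => gh v g) x' x
      ring
    have e2 : kron (fun _ : Fin n => gh v g) * kron (fun _ => ghi v g) = 1 := by
      rw [kron_mul]
      simp only [gh_mul_ghi]
      exact kron_one
    calc N * kron (fun _ => gh v g) = 1 * N * kron (fun _ => gh v g) := by rw [one_mul]
      _ = kron (fun _ => gh v g) * (kron (fun _ => ghi v g) * N * kron (fun _ => gh v g)) := by
        rw [← e2]; simp only [mul_assoc]
      _ = kron (fun _ => gh v g) * N := by rw [← e]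
  have := Subalgebra.smul_mem (SA s t v I) key (n.factorial : ℂ)⁻¹
  rwa [smul_smul, inv_mul_cancel₀ hn, one_smul] at this

theorem act_hom (g : ∀ i : Q₀, GL (Fin (v i)) ℂ) (n : ℕ) (f : R s t v) (hf : f.IsHomogeneous n) :
    (act s t v g f).IsHomogeneous n := by
  have := hf.aeval (n := 1) (fun x : Var s t v =>
    ∑ p' : Fin (v (t x.1)), ∑ q' : Fin (v (s x.1)),
      MvPolynomial.C ((g (t x.1)).val x.2.1 p') *
        MvPolynomial.X (⟨x.1, (p', q')⟩ : Var s t v) *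
        MvPolynomial.C (((g (s x.1))⁻¹).val q' x.2.2)) (by
      intro x
      refine MvPolynomial.IsHomogeneous.sum _ _ _ fun p' _ =>
        MvPolynomial.IsHomogeneous.sum _ _ _ fun q' _ => ?_
      exact ((MvPolynomial.isHomogeneous_C _ _).mul (MvPolynomial.isHomogeneous_X _ _)).mul
        (MvPolynomial.isHomogeneous_C _ _))
  rw [one_mul] at this
  exact this

theorem act_comp (g : ∀ i : Q₀, GL (Fin (v i)) ℂ) (n : ℕ) (f : R s t v) :
    MvPolynomial.homogeneousComponent n (act s t v g f) =
      act s t v g (MvPolynomial.homogeneousComponent n f) := by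
  classical
  conv_lhs => rw [← MvPolynomial.sum_homogeneousComponent f, map_sum, map_sum]
  have h : ∀ i, MvPolynomial.homogeneousComponent n
      (act s t v g (MvPolynomial.homogeneousComponent i f)) =
      if n = i then act s t v g (MvPolynomial.homogeneousComponent i f) else 0 := fun i =>
    MvPolynomial.homogeneousComponent_of_mem
      (act_hom s t v g i _ (MvPolynomial.homogeneousComponent_isHomogeneous i f))
  simp only [h]
  rw [Finset.sum_ite_eq]
  split_ifs with hn
  · rfl
  · rw [MvPolynomial.homogeneousComponent_eq_zero, map_zero]
    simpa using hn

theorem hard (f : R s t v)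
    (hinv : ∀ g : ∀ i : Q₀, GL (Fin (v i)) ℂ, (∀ i ∉ I, g i = 1) → act s t v g f = f) :
    f ∈ SA s t v I := by
  rw [← MvPolynomial.sum_homogeneousComponent f]
  refine Subalgebra.sum_mem _ fun n _ => ?_
  refine hom_case s t v I n _ (MvPolynomial.homogeneousComponent_isHomogeneous n f) fun g hg => ?_
  rw [← act_comp, hinv g hg]

end Final

end Helpers

/-- **Le Bruyn–Procesi with frozen vertices.** The `GL(v|_I)`-invariants of
`R_{Q,v}` form exactly the `ℂ`-subalgebra generated by traces along cycles through `I` and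
entries of products along paths starting and ending outside `I`. -/
theorem stmt4 (s t : Q₁ → Q₀) (v : Q₀ → ℕ) (I : Set Q₀) (f : R s t v) :
    (∀ g : ∀ i : Q₀, GL (Fin (v i)) ℂ, (∀ i ∉ I, g i = 1) → act s t v g f = f) ↔
      f ∈ Algebra.adjoin ℂ (traceGens s t v I ∪ entryGens s t v I) := by
  exact ⟨fun h => hard s t v I f h, fun h g hg => easy s t v I f h g hg⟩

end Stmt4
end
end

section
/- Let Q be a finite quiver, K ⊆ Q₀ a subset, and let v, w : Q₀ → ℕ be dimension vectors with w(i) = 0 for all i ∉ K; set v̂ := v + w. Fix a representation of Q of dimension vector w, i.e. a complex w(t a) × w(s a) matrix M_a for each arrow a (necessarily of zero size unless both s(a) and t(a) lie in K). Define the ℂ-algebra homomorphism φ : R_{Q,v̂} → R_{Q,v} on variables by: φ(x^a_{p,q}) = x^a_{p,q} if p < v(t a) and q < v(s a); φ(x^a_{p,q}) = 0 if exactly one of the conditions p ≥ v(t a), q ≥ v(s a) holds; and φ(x^a_{p,q}) = the (p − v(t a), q − v(s a)) entry of M_a (a constant) if both p ≥ v(t a) and q ≥ v(s a). Then φ maps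 the GL(v̂|_K)-fixed subalgebra of R_{Q,v̂} into, and surjectively onto, the GL(v|_K)-fixed subalgebra of R_{Q,v}. (This is the algebraic content of the closed embedding Rep(Q,v)//GL(v|_K) ↪ Rep(Q,v̂)//GL(v̂|_K) induced by taking direct sum with a fixed K-supported representation.) -/
noncomputable section

open scoped BigOperators MatrixGroups

namespace Stmt9

variable {Q₀ Q₁ : Type} [Fintype Q₀] [DecidableEq Q₀] [Fintype Q₁]

/-- Index type of the variables `x^a_{p,q}` of `R_{Q,v}`. -/
def Var (s t : Q₁ → Q₀) (v : Q₀ → ℕ) : Type :=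
  Σ a : Q₁, Fin (v (t a)) × Fin (v (s a))

/-- The polynomial ring `R_{Q,v}`. -/
abbrev R (s t : Q₁ → Q₀) (v : Q₀ → ℕ) : Type := MvPolynomial (Var s t v) ℂ

/-- The action of `g` on `R_{Q,v}` by `ℂ`-algebra automorphisms:
`x^a_{p,q} ↦ (g_{t a} · X_a · g_{s a}⁻¹)_{p,q}`. -/
def act (s t : Q₁ → Q₀) (v : Q₀ → ℕ) (g : ∀ i : Q₀, GL (Fin (v i)) ℂ) :
    R s t v →ₐ[ℂ] R s t v :=
  MvPolynomial.aeval fun x : Var s t v =>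
    ∑ p' : Fin (v (t x.1)), ∑ q' : Fin (v (s x.1)),
      MvPolynomial.C ((g (t x.1)).val x.2.1 p') *
        MvPolynomial.X (⟨x.1, (p', q')⟩ : Var s t v) *
        MvPolynomial.C (((g (s x.1))⁻¹).val q' x.2.2)

/-- The `ℂ`-algebra homomorphism `φ : R_{Q,v̂} → R_{Q,v}` (with `v̂ = v + w`) induced by
taking the direct sum with a fixed representation `M` of dimension vector `w`. -/
def phi (s t : Q₁ → Q₀) (v w : Q₀ → ℕ)
    (M : ∀ a : Q₁, Matrix (Fin (w (t a))) (Fin (w (s a))) ℂ) :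
    R s t (fun i => v i + w i) →ₐ[ℂ] R s t v :=
  MvPolynomial.aeval fun x : Var s t (fun i => v i + w i) =>
    if hp : (x.2.1 : ℕ) < v (t x.1) then
      if hq : (x.2.2 : ℕ) < v (s x.1) then
        MvPolynomial.X (⟨x.1, (⟨(x.2.1 : ℕ), hp⟩, ⟨(x.2.2 : ℕ), hq⟩)⟩ : Var s t v)
      else 0
    else
      if hq : (x.2.2 : ℕ) < v (s x.1) then 0
      else
        MvPolynomial.C (M x.1
          ⟨(x.2.1 : ℕ) - v (t x.1), by
            have hb : (x.2.1 : ℕ) < v (t x.1) + w (t x.1) := x.2.1.isLt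
            omega⟩
          ⟨(x.2.2 : ℕ) - v (s x.1), by
            have hb : (x.2.2 : ℕ) < v (s x.1) + w (s x.1) := x.2.2.isLt
            omega⟩)

set_option linter.unusedSectionVars false

section DC
variable {n : Type} [Fintype n] [DecidableEq n]
open Matrix
open scoped ComplexOrder

lemma exists_proj (A : Submodule ℂ (Matrix n n ℂ)) :
    ∃ π : Matrix n n ℂ →ₗ[ℂ] Matrix n n ℂ, (∀ X, π X ∈ A) ∧
      ∀ X, ∀ b ∈ A, (bᴴ * (X - π X)).trace = 0 := by
  let e : Matrix n n ℂ ≃ₗ[ℂ] EuclideanSpace ℂ (n × n) :=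
    (LinearEquiv.curry ℂ ℂ n n).symm.trans (WithLp.linearEquiv 2 ℂ (n × n → ℂ)).symm
  have he : ∀ X Y : Matrix n n ℂ, inner ℂ (e X) (e Y) = (Xᴴ * Y).trace := by
    intro X Y
    simp only [PiLp.inner_apply, Matrix.trace, Matrix.diag, Matrix.mul_apply, conjTranspose_apply]
    rw [Fintype.sum_prod_type, Finset.sum_comm]
    refine Finset.sum_congr rfl fun i _ => Finset.sum_congr rfl fun j _ => ?_
    simp [e, mul_comm]
    rfl
  let U := A.map e.toLinearMap
  refine ⟨e.symm.toLinearMap ∘ₗ U.starProjection.toLinearMap ∘ₗ e.toLinearMap, ?_, ?_⟩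
  · intro X
    have : U.starProjection (e X) ∈ U := Submodule.starProjection_apply_mem _ _
    obtain ⟨a, ha, hae⟩ := this
    simp only [LinearMap.comp_apply]
    have h2 : e.symm (U.starProjection (e X)) = a := by
      rw [← hae]; simp
    change e.symm (U.starProjection (e X)) ∈ A
    rw [h2]; exact ha
  · intro X b hb
    rw [← he]
    have : e X - U.starProjection (e X) ∈ Uᗮ := Submodule.sub_starProjection_mem_orthogonal _
    have h := Submodule.inner_right_of_mem_orthogonal (Submodule.mem_map_of_mem hb : e.toLinearMap b ∈ U) this
    rw [map_sub]
    change inner ℂ (e b) (e X - e (e.symm (U.starProjection (e X)))) = 0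
    rw [e.apply_symm_apply]
    exact h

/-- Finite-dimensional double commutant theorem. -/
lemma double_commutant (A : Submodule ℂ (Matrix n n ℂ)) (h1 : (1 : Matrix n n ℂ) ∈ A)
    (hmul : ∀ a ∈ A, ∀ b ∈ A, a * b ∈ A) (hstar : ∀ a ∈ A, aᴴ ∈ A) (T : Matrix n n ℂ)
    (hT : ∀ S : Matrix n n ℂ, (∀ a ∈ A, a * S = S * a) → T * S = S * T) : T ∈ A := by
  obtain ⟨π, hπA, hπ⟩ := exists_proj A
  have huniq : ∀ X, ∀ c ∈ A, (∀ b ∈ A, (bᴴ * (X - c)).trace = 0) → π X = c := by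
    intro X c hc h
    have hd : π X - c ∈ A := A.sub_mem (hπA X) hc
    have : ((π X - c)ᴴ * (π X - c)).trace = 0 := by
      have e1 := h _ hd
      have e2 := hπ X _ hd
      have : π X - c = (X - c) - (X - π X) := by abel
      conv_lhs => rw [show (π X - c)ᴴ * (π X - c) = (π X - c)ᴴ * (X - c) - (π X - c)ᴴ * (X - π X) by
        rw [← mul_sub]; congr 1]
      rw [trace_sub, e1, e2, sub_zero]
    exact sub_eq_zero.1 (Matrix.trace_conjTranspose_mul_self_eq_zero_iff.1 this)
  have hlin : ∀ a ∈ A, ∀ X, π (a * X) = a * π X := by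
    intro a ha X
    apply huniq _ _ (hmul a ha _ (hπA X))
    intro b hb
    have := hπ X (aᴴ * b) (hmul _ (hstar a ha) _ hb)
    rw [conjTranspose_mul, conjTranspose_conjTranspose] at this
    rw [← mul_sub, ← mul_assoc]; exact this
  have hone : π 1 = 1 := by
    apply huniq _ _ h1
    intro b hb; simp
  let S : n → n → Matrix n n ℂ := fun k l => Matrix.of fun i j => π (Matrix.single j k 1) i l
  have hexp : ∀ X i l, π X i l = ∑ k, (S k l * X) i k := by
    intro X i l
    conv_lhs => rw [Matrix.matrix_eq_sum_single X]
    simp only [map_sum, Matrix.sum_apply]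
    rw [Finset.sum_comm]
    refine Finset.sum_congr rfl fun k _ => ?_
    rw [Matrix.mul_apply]
    refine Finset.sum_congr rfl fun j _ => ?_
    have : Matrix.single j k (X j k) = X j k • Matrix.single j k (1:ℂ) := by simp
    rw [this, map_smul]
    simp [S, mul_comm]
  have hS : ∀ k l, ∀ a ∈ A, a * S k l = S k l * a := by
    intro k l a ha
    ext i j
    have h := congrFun (congrFun (hlin a ha (Matrix.single j k 1)) i) l
    have h2 : a * Matrix.single j k (1:ℂ) = ∑ m, a m j • Matrix.single m k (1:ℂ) := by
      ext x y
      rw [Matrix.sum_apply]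
      simp [Matrix.mul_apply, Matrix.single_apply]
      by_cases hk : k = y <;> simp [hk]
    rw [h2] at h
    simp only [map_sum, map_smul, Matrix.sum_apply] at h
    rw [Matrix.mul_apply] at h ⊢
    rw [Matrix.mul_apply]
    simp only [S, Matrix.of_apply]
    rw [← h]
    refine Finset.sum_congr rfl fun m _ => ?_
    simp [mul_comm]
  have : T = π T := by
    ext i l
    rw [hexp]
    have h3 : ∀ k, S k l * T = T * S k l := fun k => (hT _ (hS k l)).symm
    simp only [h3]
    have : T i l = (T * π 1) i l := by rw [hone, mul_one]
    rw [this, Matrix.mul_apply]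
    simp only [hexp, mul_one, Finset.mul_sum]
    rw [Finset.sum_comm]
    simp only [Matrix.mul_apply]
  rw [this]; exact hπA T

end DC

section Comb
variable {J Y : Type} [Fintype J]

lemma exists_perm_of_card [DecidableEq Y] (f g : J → Y)
    (h : ∀ y, (Finset.univ.filter fun j => f j = y).card = (Finset.univ.filter fun j => g j = y).card) :
    ∃ σ : Equiv.Perm J, ∀ j, g (σ j) = f j := by
  have e : ∀ c, {a // f a = c} ≃ {b // g b = c} := fun c =>
    Fintype.equivOfCardEq (by rw [Fintype.card_subtype, Fintype.card_subtype]; exact h c)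
  exact ⟨Equiv.ofFiberEquiv e, fun j => Equiv.ofFiberEquiv_map e j⟩

lemma exists_perm_of_card_some [DecidableEq Y] [Fintype Y] (f g : J → Option Y)
    (h : ∀ y : Y, (Finset.univ.filter fun j => f j = some y).card =
      (Finset.univ.filter fun j => g j = some y).card) :
    ∃ σ : Equiv.Perm J, ∀ j, g (σ j) = f j := by
  apply exists_perm_of_card
  rintro (_ | y)
  · have h1 := Finset.card_eq_sum_card_fiberwise (s := (Finset.univ : Finset J)) (f := f)
      (t := Finset.univ) (by simp)
    have h2 := Finset.card_eq_sum_card_fiberwise (s := (Finset.univ : Finset J)) (f := g)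
      (t := Finset.univ) (by simp)
    rw [Fintype.sum_option] at h1 h2
    simp only [h] at h1
    omega
  · exact h y

/-- Pairing lemma. -/
lemma pairing {I : Type} [Fintype I] (mon : I → (Y →₀ ℕ)) (c s : I → ℂ)
    (h0 : ∑ i, c i • MvPolynomial.monomial (mon i) (1:ℂ) = 0)
    (hs : ∀ i j, mon i = mon j → s i = s j) : ∑ i, c i * s i = 0 := by
  classical
  rw [← Finset.sum_fiberwise_of_maps_to (s := Finset.univ) (t := Finset.univ.image mon) (g := mon)
    (by intro i _; exact Finset.mem_image_of_mem _ (Finset.mem_univ i))]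
  refine Finset.sum_eq_zero fun μ hμ => ?_
  obtain ⟨i0, -, rfl⟩ := Finset.mem_image.1 hμ
  have h1 : ∑ i ∈ Finset.univ.filter (fun i => mon i = mon i0), c i * s i
      = (∑ i ∈ Finset.univ.filter (fun i => mon i = mon i0), c i) * s i0 := by
    rw [Finset.sum_mul]
    refine Finset.sum_congr rfl fun i hi => ?_
    rw [hs i i0 (Finset.mem_filter.1 hi).2]
  rw [h1]
  have h2 := congrArg (MvPolynomial.coeff (mon i0)) h0
  simp only [MvPolynomial.coeff_sum, MvPolynomial.coeff_smul, MvPolynomial.coeff_monomial,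
    MvPolynomial.coeff_zero, smul_eq_mul, mul_ite, mul_one, mul_zero] at h2
  rw [← Finset.sum_filter] at h2
  rw [h2, zero_mul]

end Comb

section Tens
variable {J N R : Type} [Fintype J] [Fintype N] [CommRing R]
open Matrix

/-- `(b₁ ⊗ ⋯ ⊗ b_d) ∘ σ`. -/
def tens (σ : Equiv.Perm J) (b : J → Matrix N N R) : Matrix (J → N) (J → N) R :=
  Matrix.of fun p q => ∏ j, b j (p j) (q (σ j))

variable [DecidableEq J]

lemma tens_mul (σ τ : Equiv.Perm J) (b c : J → Matrix N N R) :
    tens σ b * tens τ c = tens (σ.trans τ) (fun j => b j * c (σ j)) := by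
  ext p r
  simp only [tens, Matrix.mul_apply, Matrix.of_apply]
  rw [Finset.prod_univ_sum, Fintype.piFinset_univ]
  rw [← (Equiv.arrowCongr σ (Equiv.refl N)).sum_comp]
  refine Finset.sum_congr rfl fun q _ => ?_
  rw [Finset.prod_mul_distrib]
  congr 1
  · refine Finset.prod_congr rfl fun j _ => ?_
    simp [Equiv.arrowCongr]
  · rw [← Equiv.prod_comp σ]
    refine Finset.prod_congr rfl fun j _ => ?_
    simp [Equiv.arrowCongr]

lemma tens_conjTranspose (σ : Equiv.Perm J) (b : J → Matrix N N ℂ) :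
    (tens σ b)ᴴ = tens σ.symm (fun j => (b (σ.symm j))ᴴ) := by
  ext p q
  simp only [tens, Matrix.conjTranspose_apply, Matrix.of_apply, star_prod]
  rw [← Equiv.prod_comp σ.symm]
  simp

lemma tens_one [DecidableEq N] (σ : Equiv.Perm J) :
    (tens σ (fun _ => (1 : Matrix N N R))) = Matrix.of fun p q => if p = q ∘ σ then 1 else 0 := by
  ext p q
  simp only [tens, Matrix.of_apply, Matrix.one_apply]
  rw [Finset.prod_ite_zero]
  simp [funext_iff]

end Tens
section SW
open Matrix
open scoped Classical

variable {Q₀ : Type} [Fintype Q₀] [DecidableEq Q₀] (K : Set Q₀) (v : Q₀ → ℕ)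

abbrev Nd (v : Q₀ → ℕ) : Type := Σ i : Q₀, Fin (v i)

/-- Matrices on the total space commuting with the group. -/
def BB : Set (Matrix (Nd v) (Nd v) ℂ) :=
  {b | ∃ (e : Nd v → Nd v → ℂ) (β : Q₀ → ℂ), ∀ x y,
    b x y = if x.1 ∉ K ∧ y.1 ∉ K then e x y else if x = y then β x.1 else 0}

lemma BB_one : (1 : Matrix (Nd v) (Nd v) ℂ) ∈ BB K v := by
  refine ⟨fun x y => if x = y then 1 else 0, fun _ => 1, fun x y => ?_⟩
  rw [Matrix.one_apply]
  by_cases h : x = y <;> simp [h]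

lemma BB_mul {b b' : Matrix (Nd v) (Nd v) ℂ} (hb : b ∈ BB K v) (hb' : b' ∈ BB K v) :
    b * b' ∈ BB K v := by
  obtain ⟨e, β, h⟩ := hb
  obtain ⟨e', β', h'⟩ := hb'
  refine ⟨fun x y => (b * b') x y, fun i => β i * β' i, fun x z => ?_⟩
  split_ifs with h1 h2
  · rfl
  · subst h2
    have hx : x.1 ∈ K := by by_contra hx; exact h1 ⟨hx, hx⟩
    rw [Matrix.mul_apply, Finset.sum_eq_single x]
    · simp [h, h', hx]
    · intro y _ hy
      simp [h, hx, hy.symm]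
    · simp
  · rw [Matrix.mul_apply]
    refine Finset.sum_eq_zero fun y _ => ?_
    rw [h, h']
    by_cases hx : x.1 ∈ K
    · by_cases hxy : x = y
      · subst hxy; simp [hx, h2]
      · simp [hx, hxy]
    · have hz : z.1 ∈ K := by by_contra hz; exact h1 ⟨hx, hz⟩
      by_cases hyz : y = z
      · subst hyz; simp [hz, h2]
      · simp [hz, hyz]

lemma BB_star {b : Matrix (Nd v) (Nd v) ℂ} (hb : b ∈ BB K v) : bᴴ ∈ BB K v := by
  obtain ⟨e, β, h⟩ := hb
  refine ⟨fun x y => star (e y x), fun i => star (β i), fun x y => ?_⟩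
  rw [conjTranspose_apply, h]
  by_cases hxy : x = y
  · subst hxy
    simp only [if_true]
    split_ifs <;> rfl
  · simp only [hxy, Ne.symm hxy, if_false]
    by_cases hx : x.1 ∈ K <;> by_cases hy : y.1 ∈ K <;> simp [hx, hy]

lemma bd_inert_left {R : Type} [CommRing R] (g : ∀ i, Matrix (Fin (v i)) (Fin (v i)) R)
    (hg : ∀ i ∉ K, g i = 1)
    (x y : Nd v) (hx : x.1 ∉ K) : blockDiagonal' g x y = (1 : Matrix (Nd v) (Nd v) R) x y := by
  obtain ⟨i, p⟩ := x
  obtain ⟨j, q⟩ := y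
  by_cases hij : i = j
  · subst hij
    rw [blockDiagonal'_apply_eq, hg i hx, Matrix.one_apply, Matrix.one_apply]
    simp
  · rw [blockDiagonal'_apply_ne _ _ _ hij, Matrix.one_apply_ne]
    intro h; exact hij (congrArg Sigma.fst h)

lemma bd_ne {R : Type} [CommRing R] (g : ∀ i, Matrix (Fin (v i)) (Fin (v i)) R)
    (x y : Nd v) (hxy : x.1 ≠ y.1) : blockDiagonal' g x y = 0 := by
  obtain ⟨i, p⟩ := x
  obtain ⟨j, q⟩ := y
  exact blockDiagonal'_apply_ne _ _ _ hxy

lemma bd_inert_right {R : Type} [CommRing R] (g : ∀ i, Matrix (Fin (v i)) (Fin (v i)) R)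
    (hg : ∀ i ∉ K, g i = 1)
    (x y : Nd v) (hy : y.1 ∉ K) : blockDiagonal' g x y = (1 : Matrix (Nd v) (Nd v) R) x y := by
  by_cases h : x.1 = y.1
  · exact bd_inert_left K v g hg x y (h ▸ hy)
  · rw [bd_ne v g x y h, Matrix.one_apply_ne]
    rintro rfl; exact h rfl

lemma BB_comm {b : Matrix (Nd v) (Nd v) ℂ} (hb : b ∈ BB K v)
    (g : ∀ i, Matrix (Fin (v i)) (Fin (v i)) ℂ) (hg : ∀ i ∉ K, g i = 1) :
    b * blockDiagonal' g = blockDiagonal' g * b := by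
  obtain ⟨e, β, h⟩ := hb
  ext x z
  rw [Matrix.mul_apply, Matrix.mul_apply]
  have hl : x.1 ∈ K → ∑ y, b x y * blockDiagonal' g y z = β x.1 * blockDiagonal' g x z := by
    intro hx
    rw [Finset.sum_eq_single x]
    · simp [h, hx]
    · intro y _ hy; simp [h, hx, hy.symm]
    · simp
  have hr : z.1 ∈ K → ∑ y, blockDiagonal' g x y * b y z = blockDiagonal' g x z * β z.1 := by
    intro hz
    rw [Finset.sum_eq_single z]
    · simp [h, hz]
    · intro y _ hy; simp [h, hz, hy]
    · simp
  have hl' : z.1 ∉ K → ∑ y, b x y * blockDiagonal' g y z = b x z := by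
    intro hz
    simp_rw [bd_inert_right K v g hg _ z hz]
    rw [← Matrix.mul_apply, mul_one]
  have hr' : x.1 ∉ K → ∑ y, blockDiagonal' g x y * b y z = b x z := by
    intro hx
    simp_rw [bd_inert_left K v g hg x _ hx]
    rw [← Matrix.mul_apply, one_mul]
  by_cases hx : x.1 ∈ K <;> by_cases hz : z.1 ∈ K
  · rw [hl hx, hr hz]
    by_cases hxz : x.1 = z.1
    · rw [hxz, mul_comm]
    · rw [bd_ne v g x z hxz]; simp
  · have hne : x.1 ≠ z.1 := fun h' => hz (h' ▸ hx)
    rw [hl hx, bd_ne v g x z hne, mul_zero]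
    symm
    refine Finset.sum_eq_zero fun y _ => ?_
    by_cases hxy : x.1 = y.1
    · have : y ≠ z := by rintro rfl; exact hne hxy
      rw [h]; simp [← hxy, hx, this]
    · rw [bd_ne v g x y hxy, zero_mul]
  · have hne : x.1 ≠ z.1 := fun h' => hx (h' ▸ hz)
    rw [hr' hx, h]
    have hxz : x ≠ z := by rintro rfl; exact hne rfl
    simp only [hz, not_true, and_false, if_false, hxz]
    refine Finset.sum_eq_zero fun y _ => ?_
    by_cases hyz : y.1 = z.1
    · have : x ≠ y := by rintro rfl; exact hne hyz
      rw [h]; simp [hyz, hz, this]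
    · rw [bd_ne v g y z hyz, mul_zero]
  · rw [hl' hz, hr' hx]

variable (J : Type) [Fintype J]

/-- The algebra spanned by the operators `(b₁ ⊗ ⋯ ⊗ b_d) ∘ σ`. -/
def AA : Submodule ℂ (Matrix (J → Nd v) (J → Nd v) ℂ) :=
  Submodule.span ℂ {m | ∃ (σ : Equiv.Perm J) (b : J → Matrix (Nd v) (Nd v) ℂ),
    (∀ j, b j ∈ BB K v) ∧ m = tens σ b}

lemma tens_refl_one {N : Type} [Fintype N] [DecidableEq N] {R : Type} [CommRing R] :
    tens (Equiv.refl J) (fun _ => (1 : Matrix N N R)) = 1 := by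
  rw [tens_one]; ext p q
  simp [Matrix.one_apply]

lemma AA_one : 1 ∈ AA K v J := by
  refine Submodule.subset_span ⟨Equiv.refl J, fun _ => 1, fun _ => BB_one K v, ?_⟩
  rw [tens_refl_one]

lemma AA_mul : ∀ a ∈ AA K v J, ∀ b ∈ AA K v J, a * b ∈ AA K v J := by
  intro a ha b hb
  induction ha using Submodule.span_induction with
  | mem x hx =>
    obtain ⟨σ, c, hc, rfl⟩ := hx
    induction hb using Submodule.span_induction with
    | mem y hy =>
      obtain ⟨τ, c', hc', rfl⟩ := hy
      rw [tens_mul]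
      exact Submodule.subset_span ⟨_, _, fun j => BB_mul K v (hc j) (hc' _), rfl⟩
    | zero => rw [mul_zero]; exact Submodule.zero_mem _
    | add y z _ _ hy hz => rw [mul_add]; exact Submodule.add_mem _ hy hz
    | smul r y _ hy => rw [mul_smul_comm]; exact Submodule.smul_mem _ _ hy
  | zero => rw [zero_mul]; exact Submodule.zero_mem _
  | add y z _ _ hy hz => rw [add_mul]; exact Submodule.add_mem _ hy hz
  | smul r y _ hy => rw [smul_mul_assoc]; exact Submodule.smul_mem _ _ hy

lemma AA_star : ∀ a ∈ AA K v J, aᴴ ∈ AA K v J := by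
  intro a ha
  induction ha using Submodule.span_induction with
  | mem x hx =>
    obtain ⟨σ, c, hc, rfl⟩ := hx
    rw [tens_conjTranspose]
    exact Submodule.subset_span ⟨_, _, fun j => BB_star K v (hc _), rfl⟩
  | zero => rw [conjTranspose_zero]; exact Submodule.zero_mem _
  | add y z _ _ hy hz => rw [conjTranspose_add]; exact Submodule.add_mem _ hy hz
  | smul r y _ hy => rw [conjTranspose_smul]; exact Submodule.smul_mem _ _ hy

lemma AA_comm (a) (ha : a ∈ AA K v J) (g : ∀ i, Matrix (Fin (v i)) (Fin (v i)) ℂ)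
    (hg : ∀ i ∉ K, g i = 1) :
    a * tens (Equiv.refl J) (fun _ => blockDiagonal' g) =
      tens (Equiv.refl J) (fun _ => blockDiagonal' g) * a := by
  induction ha using Submodule.span_induction with
  | mem x hx =>
    obtain ⟨σ, c, hc, rfl⟩ := hx
    rw [tens_mul, tens_mul]
    simp only [BB_comm K v (hc _) g hg]
    rfl
  | zero => simp
  | add y z _ _ hy hz => rw [add_mul, mul_add, hy, hz]
  | smul r y _ hy => rw [smul_mul_assoc, mul_smul_comm, hy]

/-! Commutant of `AA`. -/
def ok (x y : Nd v) : Prop := if x.1 ∈ K then y.1 = x.1 else y = x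

variable {J}

lemma comm_perm (S : Matrix (J → Nd v) (J → Nd v) ℂ) (hS : ∀ a ∈ AA K v J, a * S = S * a)
    (σ : Equiv.Perm J) (x y : J → Nd v) : S (x ∘ σ) (y ∘ σ) = S x y := by
  have h := hS _ (Submodule.subset_span ⟨σ, fun _ => 1, fun _ => BB_one K v, rfl⟩)
  have h2 := congrFun (congrFun h (x ∘ σ)) y
  rw [tens_one, Matrix.mul_apply, Matrix.mul_apply] at h2
  simp only [Matrix.of_apply, ite_mul, mul_ite, one_mul, mul_one, zero_mul, mul_zero] at h2
  rw [Finset.sum_eq_single x, Finset.sum_eq_single (y ∘ σ)] at h2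
  · simpa using h2.symm
  · intro b _ hb; simp [hb]
  · simp
  · intro b _ hb
    rw [if_neg]
    intro h; apply hb
    funext j
    have := congrFun h (σ.symm j)
    simpa using this.symm
  · simp

lemma comm_ok (S : Matrix (J → Nd v) (J → Nd v) ℂ) (hS : ∀ a ∈ AA K v J, a * S = S * a)
    (x y : J → Nd v) (j : J) (hj : ¬ ok K v (x j) (y j)) : S x y = 0 := by
  let χ : Nd v → ℂ := fun z => if ok K v (x j) z then 1 else 0
  let b : J → Matrix (Nd v) (Nd v) ℂ := fun k => if k = j then Matrix.diagonal χ else 1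
  have hb : ∀ k, b k ∈ BB K v := by
    intro k
    by_cases hk : k = j
    · simp only [b, hk, if_true]
      refine ⟨fun z z' => if z = z' then χ z else 0,
        fun i => if i = (x j).1 then 1 else 0, fun z z' => ?_⟩
      rw [Matrix.diagonal_apply]
      by_cases hz : z = z'
      · subst hz
        simp only [if_true, and_self]
        by_cases h1 : z.1 ∈ K
        · simp only [h1, not_true, if_false, χ, ok]
          by_cases hx : (x j).1 ∈ K
          · simp [hx]
          · have h2 : z.1 ≠ (x j).1 := fun h => hx (h ▸ h1)
            have h' : z ≠ x j := by rintro rfl; exact h2 rfl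
            simp [hx, h2, h']
        · simp [h1]
      · simp [hz]
    · simp only [b, hk, if_false]; exact BB_one K v
  have htens : tens (Equiv.refl J) b = Matrix.diagonal fun p => χ (p j) := by
    ext p q
    simp only [tens, Matrix.of_apply, Equiv.refl_apply, Matrix.diagonal_apply]
    by_cases hpq : p = q
    · subst hpq
      rw [Finset.prod_eq_single j]
      · simp [b]
      · intro k _ hk; simp [b, hk]
      · simp
    · obtain ⟨k, hk⟩ := Function.ne_iff.1 hpq
      rw [if_neg hpq]
      apply Finset.prod_eq_zero (Finset.mem_univ k)
      simp only [b]
      split_ifs with hkj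
      · rw [Matrix.diagonal_apply_ne _ hk]
      · rw [Matrix.one_apply_ne hk]
  have h := hS _ (Submodule.subset_span ⟨Equiv.refl J, b, hb, rfl⟩)
  have h2 := congrFun (congrFun h x) y
  rw [htens, Matrix.diagonal_mul, Matrix.mul_diagonal] at h2
  have h3 : χ (x j) = 1 := by simp [χ, ok]
  have h4 : χ (y j) = 0 := by simp [χ, hj]
  rw [h3, h4] at h2
  simpa using h2

lemma comm_inert (S : Matrix (J → Nd v) (J → Nd v) ℂ) (hS : ∀ a ∈ AA K v J, a * S = S * a)
    (x y x' y' : J → Nd v)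
    (h : ∀ j, (x j = x' j ∧ y j = y' j) ∨
      ((x j).1 ∉ K ∧ (x' j).1 ∉ K ∧ y j = x j ∧ y' j = x' j)) : S x y = S x' y' := by
  let b : J → Matrix (Nd v) (Nd v) ℂ := fun k =>
    if x k = x' k ∧ y k = y' k then 1 else Matrix.single (x k) (x' k) 1
  have hb : ∀ k, b k ∈ BB K v := by
    intro k
    simp only [b]
    split_ifs with hk
    · exact BB_one K v
    · obtain ⟨h1, h2, -, -⟩ := (h k).resolve_left hk
      refine ⟨fun z z' => Matrix.single (x k) (x' k) 1 z z', fun _ => 0, fun z z' => ?_⟩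
      split_ifs with h3
      · rfl
      · rw [Matrix.single_apply_of_ne]
        rintro ⟨rfl, rfl⟩
        exact h3 ⟨h1, h2⟩
      · rw [Matrix.single_apply_of_ne]
        rintro ⟨rfl, rfl⟩
        exact h3 ⟨h1, h2⟩
  have hrow : ∀ q, tens (Equiv.refl J) b x q = if x' = q then 1 else 0 := by
    intro q
    simp only [tens, Matrix.of_apply, Equiv.refl_apply]
    have : ∀ j, b j (x j) (q j) = if x' j = q j then 1 else 0 := by
      intro j
      simp only [b]
      split_ifs with h1 h2 h2
      · rw [h1.1, h2, Matrix.one_apply_eq]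
      · rw [h1.1, Matrix.one_apply_ne h2]
      · rw [h2, Matrix.single_apply_same]
      · rw [Matrix.single_apply_of_ne]; tauto
    simp only [this, Finset.prod_ite_zero, funext_iff]
    simp
  have hcol : ∀ q, tens (Equiv.refl J) b q y' = if q = y then 1 else 0 := by
    intro q
    simp only [tens, Matrix.of_apply, Equiv.refl_apply]
    have : ∀ j, b j (q j) (y' j) = if q j = y j then 1 else 0 := by
      intro j
      simp only [b]
      split_ifs with h1 h2 h2
      · rw [h2, h1.2, Matrix.one_apply_eq]
      · rw [← h1.2, Matrix.one_apply_ne h2]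
      · obtain ⟨-, -, h3, h4⟩ := (h j).resolve_left h1
        rw [h2, h3, h4, Matrix.single_apply_same]
      · obtain ⟨-, -, h3, h4⟩ := (h j).resolve_left h1
        rw [Matrix.single_apply_of_ne]; rintro ⟨h5, -⟩; exact h2 (h5 ▸ h3.symm)
    simp only [this, Finset.prod_ite_zero, funext_iff]
    simp
  have h0 := hS _ (Submodule.subset_span ⟨Equiv.refl J, b, hb, rfl⟩)
  have h2 := congrFun (congrFun h0 x) y'
  rw [Matrix.mul_apply, Matrix.mul_apply] at h2
  simp only [hrow, hcol] at h2
  simpa using h2.symm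

/-! Generic group element. -/
def blk (i : Q₀) : Matrix (Fin (v i)) (Fin (v i)) (MvPolynomial (Nd v × Nd v) ℂ) :=
  if i ∈ K then Matrix.of fun p q => MvPolynomial.X (⟨i, p⟩, ⟨i, q⟩) else 1

lemma poly_vanish (c : (J → Nd v) × (J → Nd v) → ℂ)
    (hc : ∀ g : ∀ i, GL (Fin (v i)) ℂ, (∀ i ∉ K, g i = 1) →
      ∑ m, c m * tens (Equiv.refl J) (fun _ => blockDiagonal' fun i => (g i).val) m.1 m.2 = 0) :
    ∑ m, c m • tens (Equiv.refl J) (fun _ => blockDiagonal' (blk K v)) m.1 m.2 = 0 := by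
  have hdet : ∏ i, (blk K v i).det ≠ 0 := by
    intro h0
    have h1 := congrArg (MvPolynomial.eval fun z : Nd v × Nd v => if z.1 = z.2 then (1:ℂ) else 0) h0
    rw [map_prod, map_zero] at h1
    refine one_ne_zero (h1 ▸ (Finset.prod_eq_one fun i _ => ?_).symm : (1:ℂ) = 0)
    rw [RingHom.map_det]
    refine (congrArg Matrix.det (?_ : _ = (1 : Matrix (Fin (v i)) (Fin (v i)) ℂ))).trans Matrix.det_one
    ext p q
    simp only [blk, RingHom.mapMatrix_apply, Matrix.map_apply]
    split_ifs with hi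
    · simp [Matrix.one_apply]
    · by_cases hpq : p = q
      · subst hpq; simp
      · simp [hpq]
  refine (mul_eq_zero.1 (?_ : _ * ∏ i, (blk K v i).det = 0)).resolve_right hdet
  apply MvPolynomial.funext
  intro y
  rw [map_mul, map_zero]
  by_cases hy : MvPolynomial.eval y (∏ i, (blk K v i).det) = 0
  · rw [hy, mul_zero]
  rw [map_prod] at hy
  have hy' : ∀ i, ((blk K v i).map (MvPolynomial.eval y)).det ≠ 0 := by
    intro i
    have := Finset.prod_ne_zero_iff.1 hy i (Finset.mem_univ i)
    rwa [RingHom.map_det] at this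
  let g : ∀ i, GL (Fin (v i)) ℂ := fun i => Matrix.GeneralLinearGroup.mkOfDetNeZero _ (hy' i)
  have hg : ∀ i ∉ K, g i = 1 := by
    intro i hi
    apply Units.ext
    change (blk K v i).map (MvPolynomial.eval y) = 1
    rw [blk, if_neg hi]
    exact Matrix.map_one _ (map_zero _) (map_one _)
  have hP := hc g hg
  have : MvPolynomial.eval y
      (∑ m : (J → Nd v) × (J → Nd v), c m • tens (Equiv.refl J) (fun _ => blockDiagonal' (blk K v)) m.1 m.2) = 0 := by
    rw [map_sum, ← hP]
    refine Finset.sum_congr rfl fun m _ => ?_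
    rw [MvPolynomial.smul_eval]
    congr 1
    simp only [tens, Matrix.of_apply, map_prod]
    refine Finset.prod_congr rfl fun j _ => ?_
    change (blockDiagonal' (blk K v)).map (MvPolynomial.eval y) _ _ = _
    rw [Matrix.blockDiagonal'_map _ _ (map_zero _)]
    rfl
  rw [this, zero_mul]

def mon1 (x y : Nd v) : (Nd v × Nd v) →₀ ℕ := if x.1 ∈ K then Finsupp.single (x, y) 1 else 0

lemma blk_apply (x y : Nd v) : blockDiagonal' (blk K v) x y =
    if ok K v x y then MvPolynomial.monomial (mon1 K v x y) (1:ℂ) else 0 := by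
  by_cases hx : x.1 ∈ K
  · simp only [ok, hx, if_true, mon1]
    obtain ⟨i, p⟩ := x
    obtain ⟨j, q⟩ := y
    by_cases hij : i = j
    · subst hij
      simp only at hx
      rw [blockDiagonal'_apply_eq]
      simp [blk, hx, MvPolynomial.X]
    · rw [bd_ne v _ _ _ hij, if_neg (Ne.symm hij)]
  · rw [bd_inert_left K v _ (fun i hi => by rw [blk, if_neg hi]) x y hx]
    simp only [ok, hx, if_false, mon1, Matrix.one_apply, eq_comm (a := y)]
    rfl

lemma comm_mon (S : Matrix (J → Nd v) (J → Nd v) ℂ) (hS : ∀ a ∈ AA K v J, a * S = S * a)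
    (x y x' y' : J → Nd v) (h : ∀ j, ok K v (x j) (y j)) (h' : ∀ j, ok K v (x' j) (y' j))
    (he : ∑ j, mon1 K v (x j) (y j) = ∑ j, mon1 K v (x' j) (y' j)) : S x y = S x' y' := by
  let r : Nd v → Nd v → Option (Nd v × Nd v) := fun a b => if a.1 ∈ K then some (a, b) else none
  have hcount : ∀ (x y : J → Nd v) (z : Nd v × Nd v),
      (∑ j, mon1 K v (x j) (y j)) z =
        (Finset.univ.filter fun j => r (x j) (y j) = some z).card := by
    intro x y z
    rw [Finsupp.finsetSum_apply, Finset.card_filter]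
    refine Finset.sum_congr rfl fun j _ => ?_
    simp only [mon1, r]
    by_cases hx : (x j).1 ∈ K
    · simp [hx, Finsupp.single_apply]
    · simp [hx]
  obtain ⟨σ, hσ⟩ := exists_perm_of_card_some (fun j => r (x' j) (y' j)) (fun j => r (x j) (y j)) (by
    intro z
    rw [← hcount, ← hcount, he])
  rw [← comm_perm K v S hS σ x y]
  apply comm_inert K v S hS
  intro j
  have h1 := hσ j
  have h2 := h (σ j)
  have h3 := h' j
  simp only [r, ok, Function.comp] at h1 h2 h3 ⊢
  by_cases hx : (x (σ j)).1 ∈ K <;> by_cases hx' : (x' j).1 ∈ K <;> simp_all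

/-- Schur-Weyl duality: anything commuting with the group lies in `AA`. -/
lemma schur_weyl (T : Matrix (J → Nd v) (J → Nd v) ℂ)
    (hT : ∀ g : ∀ i, GL (Fin (v i)) ℂ, (∀ i ∉ K, g i = 1) →
      T * tens (Equiv.refl J) (fun _ => blockDiagonal' fun i => (g i).val) =
        tens (Equiv.refl J) (fun _ => blockDiagonal' fun i => (g i).val) * T) :
    T ∈ AA K v J := by
  apply double_commutant _ (AA_one K v J) (AA_mul K v J) (AA_star K v J)
  intro S hS
  ext p r
  let c : (J → Nd v) × (J → Nd v) → ℂ := fun m =>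
    (if m.2 = r then T p m.1 else 0) - (if m.1 = p then T m.2 r else 0)
  have hc : ∀ X : Matrix (J → Nd v) (J → Nd v) ℂ,
      ∑ m, c m * X m.1 m.2 = (T * X) p r - (X * T) p r := by
    intro X
    simp only [c, sub_mul, Finset.sum_sub_distrib, Fintype.sum_prod_type, Matrix.mul_apply]
    congr 1
    · simp
    · rw [Finset.sum_comm]
      simp [mul_comm]
  rw [← sub_eq_zero, ← hc]
  have hP := poly_vanish K v c (by
    intro g hg
    rw [hc, hT g hg, sub_self])
  let I := {m : (J → Nd v) × (J → Nd v) // ∀ j, ok K v (m.1 j) (m.2 j)}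
  let mon : I → ((Nd v × Nd v) →₀ ℕ) := fun m => ∑ j, mon1 K v (m.1.1 j) (m.1.2 j)
  have htens : ∀ m : (J → Nd v) × (J → Nd v),
      tens (Equiv.refl J) (fun _ => blockDiagonal' (blk K v)) m.1 m.2 =
      if ∀ j, ok K v (m.1 j) (m.2 j) then
        MvPolynomial.monomial (∑ j, mon1 K v (m.1 j) (m.2 j)) (1:ℂ) else 0 := by
    intro m
    simp only [tens, Matrix.of_apply, Equiv.refl_apply, blk_apply]
    rw [Finset.prod_ite_zero]
    simp only [Finset.mem_univ, true_imp_iff]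
    split_ifs
    · rw [MvPolynomial.monomial_sum_one]
    · rfl
  have hP' : ∑ m : I, c m.1 • MvPolynomial.monomial (mon m) (1:ℂ) = 0 := by
    rw [← hP]
    simp only [htens, smul_ite, smul_zero]
    rw [← Finset.sum_filter]
    symm
    exact Finset.sum_subtype _ (by simp) _
  have key := pairing mon (fun m => c m.1) (fun m => S m.1.1 m.1.2) hP' (by
    intro m m' he
    exact comm_mon K v S hS _ _ _ _ m.2 m'.2 he)
  have hext : ∑ m, c m * S m.1 m.2 = ∑ m : I, c m.1 * S m.1.1 m.1.2 := by
    rw [← Finset.sum_subtype (Finset.univ.filter fun m : (J → Nd v) × (J → Nd v) =>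
      ∀ j, ok K v (m.1 j) (m.2 j)) (by simp) (fun m => c m * S m.1 m.2)]
    rw [Finset.sum_filter]
    refine Finset.sum_congr rfl fun m _ => ?_
    split_ifs with h
    · rfl
    · push Not at h
      obtain ⟨j, hj⟩ := h
      rw [comm_ok K v S hS _ _ j hj, mul_zero]
  rw [hext]; exact key

end SW
section Poly
open Matrix MvPolynomial
open scoped Classical

instance instFintypeVar (s t : Q₁ → Q₀) (v : Q₀ → ℕ) : Fintype (Var s t v) :=
  inferInstanceAs (Fintype (Σ a : Q₁, Fin (v (t a)) × Fin (v (s a))))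

variable (s t : Q₁ → Q₀) (v : Q₀ → ℕ)

def hd (x : Var s t v) : Nd v := ⟨t x.1, x.2.1⟩
def tl (x : Var s t v) : Nd v := ⟨s x.1, x.2.2⟩

lemma var_ext (x y : Var s t v) (h : x.1 = y.1) (h1 : hd s t v x = hd s t v y)
    (h2 : tl s t v x = tl s t v y) : x = y := by
  obtain ⟨a, p, q⟩ := x
  obtain ⟨b, p', q'⟩ := y
  simp only at h
  subst h
  simp only [hd, tl, Sigma.mk.injEq, heq_eq_eq, true_and] at h1 h2
  subst h1 h2
  rfl

lemma var_exists (a : Q₁) (p q : Nd v) (hp : p.1 = t a) (hq : q.1 = s a) :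
    ∃ x : Var s t v, x.1 = a ∧ hd s t v x = p ∧ tl s t v x = q := by
  obtain ⟨i, p⟩ := p
  obtain ⟨j, q⟩ := q
  simp only at hp hq
  subst hp hq
  exact ⟨⟨a, p, q⟩, rfl, rfl, rfl⟩

lemma sum_var {M : Type} [AddCommMonoid M] (F : Var s t v → M) :
    ∑ y, F y = ∑ a, ∑ p, ∑ q, F ⟨a, (p, q)⟩ := by
  refine (Fintype.sum_sigma (fun y : (Σ a : Q₁, Fin (v (t a)) × Fin (v (s a))) => F y)).trans ?_
  refine Finset.sum_congr rfl fun a _ => ?_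
  rw [Fintype.sum_prod_type]

variable (g : ∀ i : Q₀, GL (Fin (v i)) ℂ)

abbrev GG : Matrix (Nd v) (Nd v) ℂ := blockDiagonal' fun i => (g i).val

lemma GG_inv_mul : GG v g⁻¹ * GG v g = 1 := by
  rw [GG, GG, ← blockDiagonal'_mul]
  have : (fun i => (g⁻¹ i).val * (g i).val) = (1 : ∀ i, Matrix (Fin (v i)) (Fin (v i)) ℂ) := by
    funext i
    rw [← Units.val_mul]; simp
  rw [this, blockDiagonal'_one]

lemma GG_mul_inv : GG v g * GG v g⁻¹ = 1 := by
  have := GG_inv_mul v g⁻¹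
  rwa [inv_inv] at this

def rho (x y : Var s t v) : ℂ :=
  if x.1 = y.1 then GG v g (hd s t v x) (hd s t v y) * GG v g⁻¹ (tl s t v y) (tl s t v x) else 0

lemma act_X (x : Var s t v) : act s t v g (X x) = ∑ y, rho s t v g x y • (X y : R s t v) := by
  rw [act, aeval_X, sum_var]
  obtain ⟨a, p, q⟩ := x
  rw [Finset.sum_eq_single a]
  · refine Finset.sum_congr rfl fun p' _ => Finset.sum_congr rfl fun q' _ => ?_
    simp only [rho, if_true, hd, tl, GG, blockDiagonal'_apply_eq, smul_eq_C_mul, C_mul, Pi.inv_apply]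
    exact mul_right_comm _ _ _
  · intro b _ hb
    refine Finset.sum_eq_zero fun p' _ => Finset.sum_eq_zero fun q' _ => ?_
    have h0 : rho s t v g ⟨a, (p, q)⟩ ⟨b, (p', q')⟩ = 0 := if_neg (fun h => hb h.symm)
    rw [h0, zero_smul]
  · simp

variable {J : Type} [Fintype J]

def mon {V : Type} (m : J → V) : V →₀ ℕ := ∑ j, Finsupp.single (m j) 1

lemma prod_X {V : Type} (m : J → V) :
    ∏ j, (X (m j) : MvPolynomial V ℂ) = monomial (mon m) 1 := by
  rw [mon, monomial_sum_one]
  rfl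

lemma mon_perm {V : Type} (m m' : J → V) (h : mon m = mon m') :
    ∃ σ : Equiv.Perm J, ∀ j, m' (σ j) = m j := by
  apply exists_perm_of_card
  intro y
  have h1 := DFunLike.congr_fun h y
  simp only [mon, Finsupp.finsetSum_apply, Finsupp.single_apply] at h1
  rw [Finset.card_filter, Finset.card_filter]
  exact h1

lemma mon_comp {V : Type} (m : J → V) (σ : Equiv.Perm J) : mon (m ∘ σ) = mon m := by
  exact Equiv.sum_comp σ (fun j => Finsupp.single (m j) 1)

lemma mon_degree {V : Type} (m : J → V) : (mon m).degree = Fintype.card J := by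
  simp [mon]

/-- The polynomial with coefficient tensor `c`. -/
def poly {V : Type} [Fintype V] (c : (J → V) → ℂ) : MvPolynomial V ℂ :=
  ∑ m, c m • monomial (mon m) (1:ℂ)

lemma poly_inj {V : Type} [Fintype V] (c : (J → V) → ℂ)
    (hc : ∀ m m', mon m = mon m' → c m = c m') (h : poly c = 0) (n : J → V) : c n = 0 := by
  have h1 := pairing mon c (fun m => if mon m = mon n then 1 else 0) h (by
    intro i j hij; rw [hij])
  simp only [mul_ite, mul_one, mul_zero] at h1
  rw [← Finset.sum_filter, Finset.sum_congr rfl (g := fun _ => c n)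
    (fun m hm => hc _ _ (Finset.mem_filter.1 hm).2), Finset.sum_const, smul_eq_zero] at h1
  refine h1.resolve_left ?_
  rw [Finset.card_eq_zero]
  exact Finset.ne_empty_of_mem (a := n) (by simp)

lemma exists_mon {V : Type} (d : ℕ) (μ : V →₀ ℕ) (h : μ.degree = d) : ∃ m : Fin d → V, mon m = μ := by
  subst h
  have hc : μ.toMultiset.toList.length = μ.degree := by
    rw [Multiset.length_toList, Finsupp.card_toMultiset]; rfl
  refine ⟨fun j => μ.toMultiset.toList.get (Fin.cast hc.symm j), ?_⟩
  rw [mon]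
  have h1 : ∑ j : Fin μ.degree, Finsupp.single (μ.toMultiset.toList.get (Fin.cast hc.symm j)) 1 =
      ∑ j : Fin μ.toMultiset.toList.length, Finsupp.single (μ.toMultiset.toList.get j) 1 :=
    Equiv.sum_comp (finCongr hc.symm) fun j => Finsupp.single (μ.toMultiset.toList.get j) 1
  rw [h1]
  have h2 : ∀ l : List V, ∑ j : Fin l.length, Finsupp.single (l.get j) 1 = Multiset.toFinsupp (l : Multiset V) := by
    intro l
    induction l with
    | nil => simp
    | cons a l ih =>
      refine (Fin.sum_univ_succ (n := l.length) _).trans ?_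
      rw [← Multiset.cons_coe, ← Multiset.singleton_add, map_add, Multiset.toFinsupp_singleton, ← ih]
      rfl
  rw [h2, Multiset.coe_toList]
  simp

lemma exists_symm {V : Type} [Fintype V] (d : ℕ) (h : MvPolynomial V ℂ) (hh : h.IsHomogeneous d) :
    ∃ c : (Fin d → V) → ℂ, (∀ m m', mon m = mon m' → c m = c m') ∧ poly c = h := by
  refine ⟨fun m => h.coeff (mon m) / (Finset.univ.filter fun n : Fin d → V => mon n = mon m).card, ?_, ?_⟩
  · intro m m' hm
    simp only [hm]
  · ext μ
    simp only [poly, coeff_sum, coeff_smul, coeff_monomial, smul_eq_mul, mul_ite, mul_one, mul_zero]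
    rw [← Finset.sum_filter]
    by_cases hμ : μ.degree = d
    · obtain ⟨m0, rfl⟩ := exists_mon d μ hμ
      rw [Finset.sum_congr rfl (g := fun _ => h.coeff (mon m0) /
        (Finset.univ.filter fun n : Fin d → V => mon n = mon m0).card)
        (fun m hm => by rw [(Finset.mem_filter.1 hm).2])]
      rw [Finset.sum_const, nsmul_eq_mul, mul_comm]
      have hcard : ((Finset.univ.filter fun n : Fin d → V => mon n = mon m0).card : ℂ) ≠ 0 := by
        rw [Nat.cast_ne_zero, Finset.card_ne_zero]
        exact ⟨m0, by simp⟩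
      convert div_mul_cancel₀ (h.coeff (mon m0)) hcard
      rfl
    · rw [hh.coeff_eq_zero hμ]
      refine Finset.sum_eq_zero fun m hm => ?_
      rw [(Finset.mem_filter.1 hm).2, hh.coeff_eq_zero hμ, zero_div]

lemma aeval_poly {V W : Type} [Fintype V] (c : (J → V) → ℂ) (F : MvPolynomial V ℂ →ₐ[ℂ] MvPolynomial W ℂ) :
    F (poly c) = ∑ m, c m • ∏ j, F (X (m j)) := by
  simp only [poly, ← prod_X, map_sum, map_smul, map_prod]

lemma act_poly (c : (J → Var s t v) → ℂ) :
    act s t v g (poly c) = poly fun n => ∑ m, c m * ∏ j, rho s t v g (m j) (n j) := by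
  rw [aeval_poly]
  simp only [act_X, poly]
  simp only [Finset.prod_univ_sum, Fintype.piFinset_univ, Finset.smul_sum, Finset.sum_smul]
  rw [Finset.sum_comm]
  refine Finset.sum_congr rfl fun n _ => Finset.sum_congr rfl fun m _ => ?_
  rw [← prod_X, mul_smul, Finset.prod_smul]

lemma inv_of_act (c : (J → Var s t v) → ℂ) (hc : ∀ m m', mon m = mon m' → c m = c m')
    (h : act s t v g (poly c) = poly c) (n : J → Var s t v) :
    ∑ m, c m * ∏ j, rho s t v g (m j) (n j) = c n := by
  rw [act_poly] at h
  rw [← sub_eq_zero]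
  refine poly_inj (fun n => ∑ m, c m * ∏ j, rho s t v g (m j) (n j) - c n) ?_ ?_ n
  · intro n n' hn
    rw [hc n n' hn]
    congr 1
    obtain ⟨σ, hσ⟩ := mon_perm n n' hn
    rw [← Equiv.sum_comp (Equiv.arrowCongr σ.symm (Equiv.refl (Var s t v)))]
    refine Finset.sum_congr rfl fun m _ => ?_
    have e1 : (Equiv.arrowCongr σ.symm (Equiv.refl (Var s t v))) m = m ∘ σ := by
      funext j; simp [Equiv.arrowCongr]
    rw [e1, hc _ _ (mon_comp m σ)]
    congr 1
    rw [← Equiv.prod_comp σ (fun j => rho s t v g (m j) (n' j))]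
    refine Finset.prod_congr rfl fun j _ => ?_
    rw [hσ]; rfl
  · rw [← sub_eq_zero] at h
    rw [← h]
    simp only [poly, sub_smul, Finset.sum_sub_distrib]

lemma sum_pairs (α : J → Q₁) (Φ : (J → Nd v) → (J → Nd v) → ℂ)
    (hΦ : ∀ p q, Φ p q ≠ 0 → ∀ j, (p j).1 = t (α j) ∧ (q j).1 = s (α j)) :
    ∑ m : J → Var s t v, (if ∀ j, (m j).1 = α j then
      Φ (fun j => hd s t v (m j)) (fun j => tl s t v (m j)) else 0) = ∑ p, ∑ q, Φ p q := by
  rw [← Finset.sum_filter, ← Fintype.sum_prod_type' Φ]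
  refine Finset.sum_of_injOn (fun m => ((fun j => hd s t v (m j)), (fun j => tl s t v (m j)))) ?_ ?_ ?_ ?_
  · intro m hm m' hm' h
    simp only [Finset.coe_filter, Finset.mem_univ, true_and, Set.mem_ofPred_eq, Prod.mk.injEq] at hm hm' h
    funext j
    exact var_ext s t v _ _ ((hm j).trans (hm' j).symm) (congrFun h.1 j) (congrFun h.2 j)
  · intro m _; simp
  · rintro ⟨p, q⟩ - h
    by_contra h0
    have h1 := hΦ p q h0
    choose m hm using fun j => var_exists s t v (α j) (p j) (q j) (h1 j).1 (h1 j).2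
    apply h
    refine ⟨m, by simpa using fun j => (hm j).1, ?_⟩
    simp only [Prod.mk.injEq]
    exact ⟨funext fun j => (hm j).2.1, funext fun j => (hm j).2.2⟩
  · intro m _; rfl

lemma GG_ne (x y : Nd v) (h : GG v g x y ≠ 0) : x.1 = y.1 := by
  by_contra h'
  exact h (bd_ne v _ x y h')

abbrev tg : Matrix (J → Nd v) (J → Nd v) ℂ := tens (Equiv.refl J) (fun _ => GG v g)

lemma tg_inv_mul : (tg v g⁻¹ : Matrix (J → Nd v) (J → Nd v) ℂ) * tg v g = 1 := by
  rw [tg, tg, tens_mul]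
  simp only [GG_inv_mul]
  exact tens_refl_one J

lemma tg_mul_inv : (tg v g : Matrix (J → Nd v) (J → Nd v) ℂ) * tg v g⁻¹ = 1 := by
  have := tg_inv_mul v (J := J) g⁻¹
  rwa [inv_inv] at this

lemma tg_ne (x y : J → Nd v) (h : tg v g x y ≠ 0) (j : J) : (x j).1 = (y j).1 := by
  simp only [tg, tens, Matrix.of_apply] at h
  exact GG_ne v g _ _ (Finset.prod_ne_zero_iff.1 h j (Finset.mem_univ j))

lemma prod_rho (m n : J → Var s t v) : ∏ j, rho s t v g (m j) (n j) =
    if ∀ j, (m j).1 = (n j).1 then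
      tg v g (fun j => hd s t v (m j)) (fun j => hd s t v (n j)) *
        tg v g⁻¹ (fun j => tl s t v (n j)) (fun j => tl s t v (m j)) else 0 := by
  simp only [rho]
  rw [Finset.prod_ite_zero]
  simp [tg, tens, Finset.prod_mul_distrib]

/-- coefficient tensor as a family of operators -/
def TT (c : (J → Var s t v) → ℂ) (α : J → Q₁) : Matrix (J → Nd v) (J → Nd v) ℂ :=
  Matrix.of fun q p => ∑ m, if (∀ j, (m j).1 = α j) ∧ (fun j => hd s t v (m j)) = p ∧
    (fun j => tl s t v (m j)) = q then c m else 0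

lemma TT_apply (c : (J → Var s t v) → ℂ) (n : J → Var s t v) :
    TT s t v c (fun j => (n j).1) (fun j => tl s t v (n j)) (fun j => hd s t v (n j)) = c n := by
  simp only [TT, Matrix.of_apply]
  rw [Finset.sum_eq_single n]
  · simp
  · intro m _ hm
    rw [if_neg]
    rintro ⟨h1, h2, h3⟩
    exact hm (funext fun j => var_ext s t v _ _ (h1 j) (congrFun h2 j) (congrFun h3 j))
  · simp

lemma TT_ne (c : (J → Var s t v) → ℂ) (α : J → Q₁) (q p) (h : TT s t v c α q p ≠ 0) :
    ∃ n : J → Var s t v, (∀ j, (n j).1 = α j) ∧ (fun j => hd s t v (n j)) = p ∧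
    (fun j => tl s t v (n j)) = q := by
  by_contra h'
  push Not at h'
  apply h
  simp only [TT, Matrix.of_apply]
  refine Finset.sum_eq_zero fun m _ => ?_
  rw [if_neg]
  rintro ⟨h1, h2, h3⟩
  exact h' m h1 h2 h3

lemma conj_apply (T : Matrix (J → Nd v) (J → Nd v) ℂ) (q0 p0 : J → Nd v) :
    (tg v g⁻¹ * T * tg v g : Matrix (J → Nd v) (J → Nd v) ℂ) q0 p0 = ∑ p, ∑ q, tg v g⁻¹ q0 q * T q p * tg v g p p0 := by
  rw [Matrix.mul_apply]
  refine Finset.sum_congr rfl fun p _ => ?_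
  rw [Matrix.mul_apply, Finset.sum_mul]

lemma TT_conj (c : (J → Var s t v) → ℂ)
    (hinv : ∀ n, ∑ m, c m * ∏ j, rho s t v g (m j) (n j) = c n) (α : J → Q₁) :
    tg v g⁻¹ * TT s t v c α * tg v g = TT s t v c α := by
  ext q0 p0
  rw [conj_apply, ← sum_pairs s t v α]
  swap
  · intro p q h j
    have h1 : TT s t v c α q p ≠ 0 := by
      intro h0; apply h; rw [h0]; ring
    obtain ⟨n, hn, rfl, rfl⟩ := TT_ne s t v c α q p h1
    simp only [hd, tl]
    rw [hn]; exact ⟨rfl, rfl⟩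
  by_cases hex : ∃ n : J → Var s t v, (∀ j, (n j).1 = α j) ∧ (fun j => hd s t v (n j)) = p0 ∧
    (fun j => tl s t v (n j)) = q0
  · obtain ⟨n, hn, rfl, rfl⟩ := hex
    obtain rfl : (fun j => (n j).1) = α := funext hn
    rw [TT_apply, ← hinv n]
    refine Finset.sum_congr rfl fun m _ => ?_
    rw [prod_rho]
    split_ifs with h
    · have : (fun j => (n j).1) = fun j => (m j).1 := funext fun j => (h j).symm
      rw [this, TT_apply]; ring
    · ring
  · have h0 : TT s t v c α q0 p0 = 0 := by
      by_contra h; exact hex (TT_ne s t v c α q0 p0 h)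
    rw [h0]
    refine Finset.sum_eq_zero fun m _ => ?_
    split_ifs with h
    · by_contra h1
      have h2 := left_ne_zero_of_mul (left_ne_zero_of_mul h1)
      have h3 := right_ne_zero_of_mul h1
      have h4 := tg_ne v _ _ _ h2
      have h5 := tg_ne v _ _ _ h3
      choose n hn using fun j => var_exists s t v (α j) (p0 j) (q0 j)
        (by rw [← h5 j, ← h j]; rfl) (by rw [h4 j, ← h j]; rfl)
      exact hex ⟨n, fun j => (hn j).1, funext fun j => (hn j).2.1, funext fun j => (hn j).2.2⟩
    · rfl

lemma comm_of_conj (T : Matrix (J → Nd v) (J → Nd v) ℂ) (h : tg v g⁻¹ * T * tg v g = T) :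
    T * tg v g = tg v g * T := by
  conv_rhs => rw [← h]
  rw [← mul_assoc, ← mul_assoc, tg_mul_inv, one_mul]

lemma conj_of_comm (T : Matrix (J → Nd v) (J → Nd v) ℂ) (h : T * tg v g = tg v g * T) :
    tg v g⁻¹ * T * tg v g = T := by
  rw [mul_assoc, h, ← mul_assoc, tg_inv_mul, one_mul]

/-- polynomial attached to a family of commuting operators is invariant -/
lemma poly_inv (T : (J → Q₁) → Matrix (J → Nd v) (J → Nd v) ℂ)
    (hT : ∀ α, T α * tg v g = tg v g * T α) :
    act s t v g (poly fun n => T (fun j => (n j).1) (fun j => tl s t v (n j)) (fun j => hd s t v (n j))) =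
     poly fun n => T (fun j => (n j).1) (fun j => tl s t v (n j)) (fun j => hd s t v (n j)) := by
  rw [act_poly]
  congr 1
  funext n
  conv_rhs => rw [← conj_of_comm v g _ (hT _)]
  rw [conj_apply, ← sum_pairs s t v (fun j => (n j).1)]
  · refine Finset.sum_congr rfl fun m _ => ?_
    rw [prod_rho]
    split_ifs with h
    · have : (fun j => (n j).1) = fun j => (m j).1 := funext fun j => (h j).symm
      rw [this]; ring
    · ring
  · intro p q h j
    have h2 := left_ne_zero_of_mul (left_ne_zero_of_mul h)
    have h3 := right_ne_zero_of_mul h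
    have h4 := tg_ne v _ _ _ h2 j
    have h5 := tg_ne v _ _ _ h3 j
    exact ⟨h5, h4.symm⟩

end Poly
section Lift
open Matrix MvPolynomial
open scoped Classical

variable (s t : Q₁ → Q₀) (K : Set Q₀) (v w : Q₀ → ℕ)
    (M : ∀ a : Q₁, Matrix (Fin (w (t a))) (Fin (w (s a))) ℂ)

/-- inclusion of basis vectors -/
def inc (x : Nd v) : Nd (fun i => v i + w i) := ⟨x.1, Fin.castAdd (w x.1) x.2⟩

lemma inc_inj : Function.Injective (inc v w) := by
  rintro ⟨i, p⟩ ⟨j, q⟩ h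
  have h1 : i = j := congrArg Sigma.fst h
  subst h1
  simp only [inc, Sigma.mk.injEq, heq_eq_eq, true_and] at h
  have h2 : p = q := Fin.castAdd_injective _ _ h
  rw [h2]

lemma BB_lift {b : Matrix (Nd v) (Nd v) ℂ} (hb : b ∈ BB K v) :
    ∃ b' ∈ BB K (fun i => v i + w i), ∀ x y, b' (inc v w x) (inc v w y) = b x y := by
  obtain ⟨e, β, h⟩ := hb
  let e' : Nd (fun i => v i + w i) → Nd (fun i => v i + w i) → ℂ := fun x y =>
    Function.extend (Prod.map (inc v w) (inc v w)) (Function.uncurry e) 0 (x, y)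
  refine ⟨Matrix.of fun x y => if x.1 ∉ K ∧ y.1 ∉ K then e' x y else if x = y then β x.1 else 0,
    ⟨e', β, fun x y => rfl⟩, fun x y => ?_⟩
  have he : e' (inc v w x) (inc v w y) = e x y :=
    ((inc_inj v w).prodMap (inc_inj v w)).extend_apply (Function.uncurry e) 0 (x, y)
  rw [Matrix.of_apply, he, h]
  simp only [(inc_inj v w).eq_iff]
  rfl

lemma AA_lift {J : Type} [Fintype J] (T : Matrix (J → Nd v) (J → Nd v) ℂ) (hT : T ∈ AA K v J) :
    ∃ T' ∈ AA K (fun i => v i + w i) J, ∀ p q : J → Nd v,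
      T' (fun j => inc v w (p j)) (fun j => inc v w (q j)) = T p q := by
  induction hT using Submodule.span_induction with
  | mem x hx =>
    obtain ⟨σ, b, hb, rfl⟩ := hx
    choose b' hb' h using fun j => BB_lift K v w (hb j)
    refine ⟨tens σ b', Submodule.subset_span ⟨σ, b', hb', rfl⟩, fun p q => ?_⟩
    simp only [tens, Matrix.of_apply, h]
  | zero => exact ⟨0, zero_mem _, fun p q => rfl⟩
  | add x y _ _ hx hy =>
    obtain ⟨x', hx', hx⟩ := hx
    obtain ⟨y', hy', hy⟩ := hy
    exact ⟨x' + y', add_mem hx' hy', fun p q => by rw [Matrix.add_apply, Matrix.add_apply, hx, hy]⟩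
  | smul a x _ hx =>
    obtain ⟨x', hx', hx⟩ := hx
    exact ⟨a • x', Submodule.smul_mem _ _ hx', fun p q => by rw [Matrix.smul_apply, Matrix.smul_apply, hx]⟩

/-- inclusion of variables -/
def incV (x : Var s t v) : Var s t (fun i => v i + w i) :=
  ⟨x.1, (Fin.castAdd (w (t x.1)) x.2.1, Fin.castAdd (w (s x.1)) x.2.2)⟩

lemma hd_incV (x : Var s t v) : hd s t _ (incV s t v w x) = inc v w (hd s t v x) := rfl
lemma tl_incV (x : Var s t v) : tl s t _ (incV s t v w x) = inc v w (tl s t v x) := rfl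

lemma incV_inj : Function.Injective (incV s t v w) := by
  intro x y h
  apply var_ext s t v
  · have := congrArg (fun z : Var s t (fun i => v i + w i) => z.1) h
    exact this
  · apply inc_inj v w; rw [← hd_incV, ← hd_incV, h]
  · apply inc_inj v w; rw [← tl_incV, ← tl_incV, h]

lemma phi_cc (a : Q₁) (p : Fin (v (t a))) (q : Fin (v (s a))) :
    phi s t v w M (X ⟨a, (Fin.castAdd (w (t a)) p, Fin.castAdd (w (s a)) q)⟩) = X ⟨a, (p, q)⟩ := by
  exact (aeval_X _ _).trans (Eq.trans (dif_pos p.isLt) (dif_pos q.isLt))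

lemma phi_cn (a : Q₁) (p : Fin (v (t a))) (q : Fin (w (s a))) :
    phi s t v w M (X ⟨a, (Fin.castAdd (w (t a)) p, Fin.natAdd (v (s a)) q)⟩) = 0 := by
  exact (aeval_X _ _).trans (Eq.trans (dif_pos p.isLt) (dif_neg (Nat.not_lt.2 (Nat.le_add_right _ _))))

lemma phi_nc (a : Q₁) (p : Fin (w (t a))) (q : Fin (v (s a))) :
    phi s t v w M (X ⟨a, (Fin.natAdd (v (t a)) p, Fin.castAdd (w (s a)) q)⟩) = 0 := by
  exact (aeval_X _ _).trans (Eq.trans (dif_neg (Nat.not_lt.2 (Nat.le_add_right _ _))) (dif_pos q.isLt))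

lemma phi_nn (a : Q₁) (p : Fin (w (t a))) (q : Fin (w (s a))) :
    phi s t v w M (X ⟨a, (Fin.natAdd (v (t a)) p, Fin.natAdd (v (s a)) q)⟩) = C (M a p q) := by
  exact (aeval_X _ _).trans (Eq.trans (dif_neg (Nat.not_lt.2 (Nat.le_add_right _ _))) (Eq.trans (dif_neg (Nat.not_lt.2 (Nat.le_add_right _ _)))
    (congrArg C (congrArg₂ (M a) (Fin.ext (Nat.add_sub_cancel_left ..)) (Fin.ext (Nat.add_sub_cancel_left ..))))))

lemma phi_off (x : Var s t (fun i => v i + w i)) (hx : x ∉ Set.range (incV s t v w)) :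
    ∃ c : ℂ, phi s t v w M (X x) = C c := by
  obtain ⟨a, p, q⟩ := x
  change Fin (v (t a) + w (t a)) at p
  change Fin (v (s a) + w (s a)) at q
  induction p using Fin.addCases with
  | left p =>
    induction q using Fin.addCases with
    | left q => exact absurd ⟨⟨a, (p, q)⟩, rfl⟩ hx
    | right q => exact ⟨0, by rw [C_0]; exact phi_cn s t v w M a p q⟩
  | right p =>
    induction q using Fin.addCases with
    | left q => exact ⟨0, by rw [C_0]; exact phi_nc s t v w M a p q⟩
    | right q => exact ⟨_, phi_nn s t v w M a p q⟩

lemma phi_deg (x : Var s t (fun i => v i + w i)) : (phi s t v w M (X x)).totalDegree ≤ 1 := by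
  by_cases hx : x ∈ Set.range (incV s t v w)
  · obtain ⟨y, rfl⟩ := hx
    have : phi s t v w M (X (incV s t v w y)) = X y := phi_cc s t v w M y.1 y.2.1 y.2.2
    rw [this, totalDegree_X]
  · obtain ⟨c, hc⟩ := phi_off s t v w M x hx
    rw [hc, totalDegree_C]; exact zero_le_one

lemma phi_poly {J : Type} [Fintype J] (c : (J → Var s t v) → ℂ)
    (c' : (J → Var s t (fun i => v i + w i)) → ℂ)
    (h : ∀ m, c' (fun j => incV s t v w (m j)) = c m) (μ : Var s t v →₀ ℕ)
    (hμ : Fintype.card J ≤ μ.degree) :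
    coeff μ (phi s t v w M (poly c')) = coeff μ (poly c) := by
  rw [aeval_poly, poly, coeff_sum, coeff_sum]
  symm
  apply Fintype.sum_of_injective (fun (m : J → Var s t v) j => incV s t v w (m j))
  · intro m m' hm
    funext j
    exact incV_inj s t v w (congrFun hm j)
  · intro n hn
    obtain ⟨j0, hj0⟩ : ∃ j, n j ∉ Set.range (incV s t v w) := by
      by_contra hcon
      push Not at hcon
      choose m hm using hcon
      exact hn ⟨m, funext hm⟩
    rw [coeff_smul, coeff_eq_zero_of_totalDegree_lt, smul_zero]
    refine lt_of_lt_of_le ?_ hμ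
    refine lt_of_le_of_lt (totalDegree_finsetProd _ _) ?_
    rw [← Finset.card_univ, Finset.card_eq_sum_ones]
    refine Finset.sum_lt_sum (fun j _ => phi_deg s t v w M (n j)) ⟨j0, Finset.mem_univ _, ?_⟩
    obtain ⟨e, he⟩ := phi_off s t v w M _ hj0
    rw [he, totalDegree_C]; exact zero_lt_one
  · intro m
    have : ∀ y, phi s t v w M (X (incV s t v w y)) = X y :=
      fun y => phi_cc s t v w M y.1 y.2.1 y.2.2
    simp only [h, this, prod_X]

lemma hom_lift (d : ℕ) (h : R s t v) (hh : h.IsHomogeneous d)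
    (hinv : ∀ g : ∀ i : Q₀, GL (Fin (v i)) ℂ, (∀ i ∉ K, g i = 1) → act s t v g h = h) :
    ∃ F : R s t (fun i => v i + w i),
        (∀ g : ∀ i : Q₀, GL (Fin (v i + w i)) ℂ, (∀ i ∉ K, g i = 1) →
          act s t (fun i => v i + w i) g F = F) ∧
        ∀ μ : Var s t v →₀ ℕ, d ≤ μ.degree → coeff μ (phi s t v w M F) = coeff μ h := by
  obtain ⟨c, hc, rfl⟩ := exists_symm d h hh
  have hA : ∀ α, TT s t v c α ∈ AA K v (Fin d) := fun α =>
    schur_weyl K v _ fun g hg => comm_of_conj v g _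
      (TT_conj s t v g c (inv_of_act s t v g c hc (hinv g hg)) α)
  choose T hT hTe using fun α => AA_lift K v w _ (hA α)
  refine ⟨poly fun n => T (fun j => (n j).1) (fun j => tl s t _ (n j)) (fun j => hd s t _ (n j)),
    fun g hg => poly_inv s t (fun i => v i + w i) g T fun α => ?_, fun μ hμ => ?_⟩
  · refine AA_comm K _ _ _ (hT α) (fun i => (g i).val) fun i hi => ?_
    rw [hg i hi]; rfl
  · refine phi_poly s t v w M c _ (fun m => ?_) μ (by simpa using hμ)
    simp only [hd_incV, tl_incV, hTe]
    exact TT_apply s t v c m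

lemma act_hom (g : ∀ i : Q₀, GL (Fin (v i)) ℂ) (n : ℕ) (f : R s t v) (hf : f.IsHomogeneous n) :
    (act s t v g f).IsHomogeneous n := by
  have := hf.aeval (n := 1) (fun x => act s t v g (X x)) (fun x => by
    rw [act_X]
    refine IsHomogeneous.sum _ _ _ fun y _ => ?_
    rw [smul_eq_C_mul]
    exact (isHomogeneous_X ℂ y).C_mul _)
  rw [one_mul] at this
  convert this using 1
  rw [act]
  simp only [aeval_X]

lemma act_hc (g : ∀ i : Q₀, GL (Fin (v i)) ℂ) (n : ℕ) (f : R s t v) :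
    act s t v g (homogeneousComponent n f) = homogeneousComponent n (act s t v g f) := by
  conv_rhs => rw [← sum_homogeneousComponent f]
  rw [map_sum, map_sum]
  have h1 : ∀ i, homogeneousComponent n (act s t v g (homogeneousComponent i f)) =
      if n = i then act s t v g (homogeneousComponent i f) else 0 := fun i =>
    homogeneousComponent_of_mem (act_hom s t v g i _ (homogeneousComponent_isHomogeneous i f))
  simp only [h1]
  rw [Finset.sum_ite_eq]
  split_ifs with h
  · rfl
  · rw [homogeneousComponent_eq_zero, map_zero]
    simpa using h

/-- block diagonal extension by the identity -/
def ext1 {n : ℕ} (m : ℕ) (A : Matrix (Fin n) (Fin n) ℂ) : Matrix (Fin (n + m)) (Fin (n + m)) ℂ :=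
  (fromBlocks A 0 0 (1 : Matrix (Fin m) (Fin m) ℂ)).submatrix finSumFinEquiv.symm finSumFinEquiv.symm

lemma ext1_mul {n m : ℕ} (A B : Matrix (Fin n) (Fin n) ℂ) : ext1 m A * ext1 m B = ext1 m (A * B) := by
  rw [ext1, ext1, ext1, submatrix_mul_equiv, fromBlocks_multiply]
  simp

lemma ext1_one {n m : ℕ} : ext1 m (1 : Matrix (Fin n) (Fin n) ℂ) = 1 := by
  rw [ext1, fromBlocks_one, submatrix_one_equiv]

lemma ext1_cc {n m : ℕ} (A : Matrix (Fin n) (Fin n) ℂ) (p q : Fin n) :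
    ext1 m A (Fin.castAdd m p) (Fin.castAdd m q) = A p q := by simp [ext1]
lemma ext1_cn {n m : ℕ} (A : Matrix (Fin n) (Fin n) ℂ) (p : Fin n) (q : Fin m) :
    ext1 m A (Fin.castAdd m p) (Fin.natAdd n q) = 0 := by simp [ext1]
lemma ext1_nc {n m : ℕ} (A : Matrix (Fin n) (Fin n) ℂ) (p : Fin m) (q : Fin n) :
    ext1 m A (Fin.natAdd n p) (Fin.castAdd m q) = 0 := by simp [ext1]
lemma ext1_nn {n m : ℕ} (A : Matrix (Fin n) (Fin n) ℂ) (p q : Fin m) :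
    ext1 m A (Fin.natAdd n p) (Fin.natAdd n q) = (1 : Matrix (Fin m) (Fin m) ℂ) p q := by simp [ext1]

def extG (g : ∀ i : Q₀, GL (Fin (v i)) ℂ) (i : Q₀) : GL (Fin (v i + w i)) ℂ :=
  ⟨ext1 (w i) (g i).val, ext1 (w i) (g i)⁻¹.val,
    by rw [ext1_mul, ← Units.val_mul, mul_inv_cancel, Units.val_one, ext1_one],
    by rw [ext1_mul, ← Units.val_mul, inv_mul_cancel, Units.val_one, ext1_one]⟩

lemma act_X_hat (g : ∀ i : Q₀, GL (Fin (v i)) ℂ) (a : Q₁) (p : Fin (v (t a) + w (t a)))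
    (q : Fin (v (s a) + w (s a))) :
    act s t (fun i => v i + w i) (extG v w g) (X ⟨a, (p, q)⟩) =
    ∑ p' : Fin (v (t a) + w (t a)), ∑ q' : Fin (v (s a) + w (s a)),
      C (ext1 (w (t a)) (g (t a)).val p p') * X ⟨a, (p', q')⟩ *
        C (ext1 (w (s a)) (g (s a))⁻¹.val q' q) := by
  exact aeval_X _ _

lemma phi_C (c : ℂ) : phi s t v w M (C c) = C c := (phi s t v w M).commutes c
lemma act_C (g : ∀ i : Q₀, GL (Fin (v i)) ℂ) (c : ℂ) : act s t v g (C c) = C c :=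
  (act s t v g).commutes c

lemma equivar (g : ∀ i : Q₀, GL (Fin (v i)) ℂ) (f : R s t (fun i => v i + w i)) :
    act s t v g (phi s t v w M f) = phi s t v w M (act s t (fun i => v i + w i) (extG v w g) f) := by
  have : (act s t v g).comp (phi s t v w M) =
      (phi s t v w M).comp (act s t (fun i => v i + w i) (extG v w g)) := by
    apply MvPolynomial.algHom_ext
    rintro ⟨a, p, q⟩
    rw [AlgHom.comp_apply, AlgHom.comp_apply]
    change Fin (v (t a) + w (t a)) at p
    change Fin (v (s a) + w (s a)) at q
    rw [act_X_hat]
    simp only [map_sum, map_mul, phi_C]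
    rw [Fin.sum_univ_add]
    simp only [Fin.sum_univ_add, phi_cc, phi_cn, phi_nc, phi_nn]
    induction p using Fin.addCases with
    | left p =>
      induction q using Fin.addCases with
      | left q =>
        rw [phi_cc]
        refine (aeval_X _ _).trans ?_
        simp [ext1_cc, ext1_cn, ext1_nc, ext1_nn]
        rfl
      | right q =>
        rw [phi_cn]
        simp [ext1_cc, ext1_cn, ext1_nc, ext1_nn]
    | right p =>
      induction q using Fin.addCases with
      | left q =>
        rw [phi_nc]
        simp [ext1_cc, ext1_cn, ext1_nc, ext1_nn]
      | right q =>
        rw [phi_nn, act_C]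
        simp only [ext1_cc, ext1_cn, ext1_nc, ext1_nn, Matrix.one_apply]
        simp [apply_ite C, ite_mul, mul_ite]
  exact DFunLike.congr_fun this f

lemma part_one (f : R s t (fun i => v i + w i))
    (hf : ∀ g : ∀ i : Q₀, GL (Fin (v i + w i)) ℂ, (∀ i ∉ K, g i = 1) →
        act s t (fun i => v i + w i) g f = f)
    (g' : ∀ i : Q₀, GL (Fin (v i)) ℂ) (hg : ∀ i ∉ K, g' i = 1) :
    act s t v g' (phi s t v w M f) = phi s t v w M f := by
  rw [equivar, hf]
  intro i hi
  apply Units.ext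
  change ext1 (w i) (g' i).val = 1
  rw [hg i hi, Units.val_one, ext1_one]

lemma part_two (n : ℕ) : ∀ f' : R s t v,
    (∀ g' : ∀ i : Q₀, GL (Fin (v i)) ℂ, (∀ i ∉ K, g' i = 1) → act s t v g' f' = f') →
    (∀ μ : Var s t v →₀ ℕ, n ≤ μ.degree → coeff μ f' = 0) →
      ∃ f : R s t (fun i => v i + w i),
        (∀ g : ∀ i : Q₀, GL (Fin (v i + w i)) ℂ, (∀ i ∉ K, g i = 1) →
          act s t (fun i => v i + w i) g f = f) ∧
        phi s t v w M f = f' := by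
  induction n with
  | zero =>
    intro f' _ h0
    refine ⟨0, fun g _ => map_zero _, ?_⟩
    rw [map_zero]
    ext μ
    rw [h0 μ (Nat.zero_le _), coeff_zero]
  | succ n ih =>
    intro f' hf' h0
    obtain ⟨F, hF, hFc⟩ := hom_lift s t K v w M n (homogeneousComponent n f')
      (homogeneousComponent_isHomogeneous n f') (fun g hg => by rw [act_hc, hf' g hg])
    obtain ⟨f, hf, hfe⟩ := ih (f' - phi s t v w M F)
      (fun g hg => by rw [map_sub, hf' g hg, part_one s t K v w M F hF g hg])
      (fun μ hμ => by
        rw [coeff_sub, hFc μ hμ, coeff_homogeneousComponent]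
        split_ifs with h
        · exact sub_self _
        · rw [sub_zero]; exact h0 μ (by omega))
    refine ⟨f + F, fun g hg => by rw [map_add, hf g hg, hF g hg], ?_⟩
    rw [map_add, hfe, sub_add_cancel]

end Lift

/-- The homomorphism `φ` maps the `GL(v̂|_K)`-invariants of `R_{Q,v̂}`
into, and surjectively onto, the `GL(v|_K)`-invariants of `R_{Q,v}`. -/
theorem stmt9 (s t : Q₁ → Q₀) (K : Set Q₀) (v w : Q₀ → ℕ)
    (hw : ∀ i ∉ K, w i = 0)
    (M : ∀ a : Q₁, Matrix (Fin (w (t a))) (Fin (w (s a))) ℂ) :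
    (∀ f : R s t (fun i => v i + w i),
      (∀ g : ∀ i : Q₀, GL (Fin (v i + w i)) ℂ, (∀ i ∉ K, g i = 1) →
        act s t (fun i => v i + w i) g f = f) →
      ∀ g' : ∀ i : Q₀, GL (Fin (v i)) ℂ, (∀ i ∉ K, g' i = 1) →
        act s t v g' (phi s t v w M f) = phi s t v w M f) ∧
    (∀ f' : R s t v,
      (∀ g' : ∀ i : Q₀, GL (Fin (v i)) ℂ, (∀ i ∉ K, g' i = 1) →
        act s t v g' f' = f') →
      ∃ f : R s t (fun i => v i + w i),
        (∀ g : ∀ i : Q₀, GL (Fin (v i + w i)) ℂ, (∀ i ∉ K, g i = 1) →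
          act s t (fun i => v i + w i) g f = f) ∧
        phi s t v w M f = f') := by
  refine ⟨fun f hf g' hg => part_one s t K v w M f hf g' hg, fun f' hf' => ?_⟩
  refine part_two s t K v w M (f'.totalDegree + 1) f' hf' fun μ hμ => ?_
  exact MvPolynomial.coeff_eq_zero_of_totalDegree_lt (Nat.lt_of_succ_le hμ)

end Stmt9
end
end
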